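/- Assume the Irrationality Hypothesis. Then a 0–1 law holds for first-order logic: for every L⁺-sentence φ, the limit lim_{n→∞} P_n(G_n ⊨ φ) exists and equals 0 or 1. -/

import Mathlib

open FirstOrder Filter Topology
open scoped Classical

/-- The finite relational language with relation symbols `R i` of arity `k i`, for `i : Fin p`. -/
def Lang (p : ℕ) (k : Fin p → ℕ) : FirstOrder.Language where
  Functions := fun _ => Empty
  Relations := fun n => { i : Fin p // k i = n }

variable {p : ℕ}

section StructureDefs

/-- The relation `R i` holds on the finite set `C` (set-version of the relation). -/
def HoldsOn (k : Fin p → ℕ) {M : Type*} [(Lang p k).Structure M]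
    (i : Fin p) (C : Finset M) : Prop :=
  ∃ v : Fin (k i) → M, Function.Injective v ∧ Finset.image v Finset.univ = C ∧
    Language.Structure.RelMap (L := Lang p k) (⟨i, rfl⟩ : (Lang p k).Relations (k i)) v

/-- `w i A` : the number of `k i`-element subsets of `A` on which `R i` holds. -/
noncomputable def w (k : Fin p → ℕ) {M : Type*} [(Lang p k).Structure M]
    (i : Fin p) (A : Finset M) : ℕ :=
  Set.ncard {C : Finset M | C ⊆ A ∧ C.card = k i ∧ HoldsOn k i C}

/-- `e(A) = Σ_i α_i · w_i(A)`. -/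
noncomputable def eVal (k : Fin p → ℕ) (α : Fin p → ℝ) {M : Type*} [(Lang p k).Structure M]
    (A : Finset M) : ℝ :=
  ∑ i : Fin p, α i * (w k i A : ℝ)

/-- `δ(A) = |A| − e(A)`. -/
noncomputable def delta (k : Fin p → ℕ) (α : Fin p → ℝ) {M : Type*} [(Lang p k).Structure M]
    (A : Finset M) : ℝ :=
  (A.card : ℝ) - eVal k α A

/-- A structure is symmetric and irreflexive: relations hold only on tuples of pairwise
distinct elements and are invariant under permutations of the tuple. -/
def SymmIrr (k : Fin p → ℕ) (M : Type*) [(Lang p k).Structure M] : Prop :=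
  (∀ (n : ℕ) (r : (Lang p k).Relations n) (v : Fin n → M),
      Language.Structure.RelMap r v → Function.Injective v) ∧
  (∀ (n : ℕ) (r : (Lang p k).Relations n) (v : Fin n → M) (σ : Equiv.Perm (Fin n)),
      Language.Structure.RelMap r v → Language.Structure.RelMap r (v ∘ σ))

/-- Membership in the class `K`: a symmetric irreflexive structure all of whose finite
substructures have (hereditarily) nonnegative `δ`. -/
def InK (k : Fin p → ℕ) (α : Fin p → ℝ) (M : Type*) [(Lang p k).Structure M] : Prop :=
  SymmIrr k M ∧ ∀ A : Finset M, 0 ≤ delta k α A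

/-- A finite structure is in `K_α` if it is symmetric irreflexive and `δ(A) ≥ 0` for every
substructure. -/
def InKalpha (k : Fin p → ℕ) (α : Fin p → ℝ) (B : Type*) [(Lang p k).Structure B] : Prop :=
  SymmIrr k B ∧ ∀ S : Finset B, 0 ≤ delta k α S

/-- `d_B(X) = inf { δ(Y) : X ⊆ Y ⊆ B }` (relative version, inside the finite set `B`). -/
noncomputable def dRel (k : Fin p → ℕ) (α : Fin p → ℝ) {M : Type*} [(Lang p k).Structure M]
    (B X : Finset M) : ℝ :=
  sInf {r : ℝ | ∃ Y : Finset M, X ⊆ Y ∧ Y ⊆ B ∧ r = delta k α Y}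

/-- `A ≤_s B` for finite sets: `A ⊆ B` and `d_A(X) = d_B(X)` for all `X ⊆ A`. -/
def StrongIn (k : Fin p → ℕ) (α : Fin p → ℝ) {M : Type*} [(Lang p k).Structure M]
    (A B : Finset M) : Prop :=
  A ⊆ B ∧ ∀ X : Finset M, X ⊆ A → dRel k α A X = dRel k α B X

/-- `A ≤_i B` (intrinsic extension): there is no `A'` with `A ⊆ A' ⊊ B` and `A' ≤_s B`. -/
def IntrinsicIn (k : Fin p → ℕ) (α : Fin p → ℝ) {M : Type*} [(Lang p k).Structure M]
    (A B : Finset M) : Prop :=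
  A ⊆ B ∧ ∀ A' : Finset M, A ⊆ A' → A' ⊂ B → ¬ StrongIn k α A' B

/-- `cl^m_M(A)`: the union of all `B ⊆ M` with `A ≤_i B` and `|B − A| < m`. -/
def cl (k : Fin p → ℕ) (α : Fin p → ℝ) {M : Type*} [(Lang p k).Structure M]
    (m : ℕ) (A : Finset M) : Set M :=
  {x : M | ∃ B : Finset M, IntrinsicIn k α A B ∧ (B \ A).card < m ∧ x ∈ B}

/-- `C` and `B'` are freely joined over `A` (inside the ambient structure): they intersect in
`A` and every relation on a subset of `C ∪ B'` lives entirely inside `C` or inside `B'`. -/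
def FreelyJoined (k : Fin p → ℕ) {M : Type*} [(Lang p k).Structure M]
    (A C B' : Set M) : Prop :=
  C ∩ B' = A ∧
    ∀ (i : Fin p) (S : Finset M), ↑S ⊆ C ∪ B' → HoldsOn k i S → (↑S ⊆ C ∨ ↑S ⊆ B')

/-- `g` is an embedding (of relational structures). -/
def IsEmb (k : Fin p → ℕ) {M N : Type*} [(Lang p k).Structure M] [(Lang p k).Structure N]
    (g : M → N) : Prop :=
  Function.Injective g ∧
    ∀ (n : ℕ) (r : (Lang p k).Relations n) (v : Fin n → M),
      (Language.Structure.RelMap r (g ∘ v) ↔ Language.Structure.RelMap r v)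

/-- `g` restricted to `A` is an embedding of the substructure on `A`. -/
def IsEmbOn (k : Fin p → ℕ) {M N : Type*} [(Lang p k).Structure M] [(Lang p k).Structure N]
    (A : Finset M) (g : M → N) : Prop :=
  Set.InjOn g ↑A ∧
    ∀ (n : ℕ) (r : (Lang p k).Relations n) (v : Fin n → M), (∀ j, v j ∈ A) →
      (Language.Structure.RelMap r (g ∘ v) ↔ Language.Structure.RelMap r v)

/-- `h` restricts to an isomorphism from the induced structure on `S` onto `S'`. -/
def IsIsoOn (k : Fin p → ℕ) {M N : Type*} [(Lang p k).Structure M] [(Lang p k).Structure N]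
    (S : Set M) (S' : Set N) (h : M → N) : Prop :=
  Set.InjOn h S ∧ h '' S = S' ∧
    ∀ (n : ℕ) (r : (Lang p k).Relations n) (v : Fin n → M), (∀ j, v j ∈ S) →
      (Language.Structure.RelMap r (h ∘ v) ↔ Language.Structure.RelMap r v)

/-- A countable structure `M ∈ K` is `(K_α, ≤_s)`-semigeneric if for every `A ≤_s B` with
`B ∈ K_α` finite and every embedding `g` of `A` into `M`, and each `m`, there is an embedding
`ĝ` of `B` into `M` extending `g` whose image adds nothing to the `m`-closure of `gA` and is
freely joined with `cl^m(gA)` over `gA`. -/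
def Semigeneric (k : Fin p → ℕ) (α : Fin p → ℝ) (M : Type*) [(Lang p k).Structure M] : Prop :=
  Countable M ∧ InK k α M ∧
    ∀ (B : Type) (_ : Fintype B) (_ : (Lang p k).Structure B), InKalpha k α B →
      ∀ A : Finset B, StrongIn k α A Finset.univ →
        ∀ g : B → M, IsEmbOn k A g → ∀ m : ℕ,
          ∃ g' : B → M, IsEmb k g' ∧ (∀ a ∈ A, g' a = g a) ∧
            cl k α m (Finset.image g' Finset.univ) =
              ↑(Finset.image g' Finset.univ) ∪ cl k α m (Finset.image g A) ∧
            FreelyJoined k (↑(Finset.image g A) : Set M) (cl k α m (Finset.image g A))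
              (↑(Finset.image g' Finset.univ))

end StructureDefs

section FormulaDefs

/-- A formula is existential if it is an existential quantifier prefix applied to a
quantifier-free formula. -/
def IsExistential (k : Fin p → ℕ) {r : ℕ} (φ : (Lang p k).Formula (Fin r)) : Prop :=
  ∃ (m : ℕ) (ψ : (Lang p k).BoundedFormula (Fin r) m), ψ.IsQF ∧ φ = ψ.exs

/-- Boolean combinations of existential formulas. -/
inductive IsBoolCombExistential (k : Fin p → ℕ) {r : ℕ} :
    (Lang p k).Formula (Fin r) → Prop
  | of_existential (φ) : IsExistential k φ → IsBoolCombExistential k φ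
  | not (φ) : IsBoolCombExistential k φ → IsBoolCombExistential k φ.not
  | inf (φ ψ) : IsBoolCombExistential k φ → IsBoolCombExistential k ψ →
      IsBoolCombExistential k (φ ⊓ ψ)

end FormulaDefs

section Probability

/-- A configuration of potential relations on `{1,…,n}`: for each relation symbol, a Boolean
choice on each finite subset. -/
abbrev Config (p n : ℕ) := (i : Fin p) → Finset (Fin n) → Bool

/-- The valid configurations: `R i` may only hold on sets of size `k i`. -/
noncomputable def validE (k : Fin p → ℕ) (n : ℕ) : Finset (Config p n) :=
  Finset.univ.filter (fun E => ∀ (i : Fin p) (C : Finset (Fin n)), E i C = true → C.card = k i)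

/-- The probability of the configuration `E`: independently for each `i` and each
`k i`-element set `C`, the relation `R i` holds on `C` with probability `γ i · n^{-α i}`. -/
noncomputable def weight (k : Fin p → ℕ) (α γ : Fin p → ℝ) (n : ℕ) (E : Config p n) : ℝ :=
  ∏ i : Fin p, ∏ C ∈ Finset.univ.filter (fun C : Finset (Fin n) => C.card = k i),
    (if E i C = true then γ i * (n : ℝ) ^ (-(α i)) else 1 - γ i * (n : ℝ) ^ (-(α i)))

/-- The probability `P_n` of an event (a set of configurations). -/
noncomputable def Pev (k : Fin p → ℕ) (α γ : Fin p → ℝ) (n : ℕ)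
    (Q : Config p n → Prop) : ℝ :=
  ∑ E ∈ validE k n, if Q E then weight k α γ n E else 0

/-- The random `L⁺`-structure `G_n` on `Fin n` determined by the configuration `E`. -/
def structOf (k : Fin p → ℕ) (n : ℕ) (E : Config p n) : (Lang p k).Structure (Fin n) where
  funMap := fun {_} f _ => f.elim
  RelMap := fun {_} r v => Function.Injective v ∧ E r.1 (Finset.image v Finset.univ) = true

/-- The probability that `G_n ⊨ φ`. -/
noncomputable def Pn (k : Fin p → ℕ) (α γ : Fin p → ℝ) (n : ℕ)
    (φ : (Lang p k).Sentence) : ℝ :=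
  Pev k α γ n (fun E => letI := structOf k n E; (Fin n) ⊨ φ)

/-- The Irrationality Hypothesis: `α_0, …, α_{p−1}, 1` are linearly independent over `ℚ`. -/
def IrrHyp (α : Fin p → ℝ) : Prop :=
  LinearIndependent ℚ (Fin.snoc α (1 : ℝ) : Fin (p + 1) → ℝ)

/-- The almost sure theory `T^α`: the sentences with limit probability 1. -/
noncomputable def Talpha (k : Fin p → ℕ) (α γ : Fin p → ℝ) : (Lang p k).Theory :=
  {φ : (Lang p k).Sentence | Tendsto (fun n => Pn k α γ n φ) atTop (𝓝 1)}

/-- Auxiliary: `M`, equipped with the structure `S`, satisfies the sentence `φ`. -/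
def RealizeS (k : Fin p → ℕ) (M : Type*) (S : (Lang p k).Structure M)
    (φ : (Lang p k).Sentence) : Prop :=
  letI := S; M ⊨ φ

/-- Auxiliary: `M`, equipped with the structure `S`, is a model of the theory `T`. -/
def ModelsT (k : Fin p → ℕ) (M : Type*) (S : (Lang p k).Structure M)
    (T : (Lang p k).Theory) : Prop :=
  ∀ φ ∈ T, RealizeS k M S φ

end Probability

section FiniteProbability

/-- Expectation of `f` when the coordinates `ω e` are independent and `ω e = true` has
probability `q e`. -/
noncomputable def ex {ι : Type*} [Fintype ι] (q : ι → ℝ) (f : (ι → Bool) → ℝ) : ℝ :=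
  ∑ ω, (∏ e, if ω e then q e else 1 - q e) * f ω

/-- Probability of the event `Q` in the product space of `ex`. -/
noncomputable def pr {ι : Type*} [Fintype ι] (q : ι → ℝ) (Q : (ι → Bool) → Prop) : ℝ :=
  ex q (fun ω => if Q ω then 1 else 0)

variable {ι : Type*} [Fintype ι] {q : ι → ℝ}

lemma ex_prod (q : ι → ℝ) (φ : ι → Bool → ℝ) :
    ex q (fun ω => ∏ e, φ e (ω e)) = ∏ e, (q e * φ e true + (1 - q e) * φ e false) := by
  have h := Finset.prod_univ_sum (fun _ : ι => (Finset.univ : Finset Bool))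
    (fun e b => (if b then q e else 1 - q e) * φ e b)
  simp only [Fintype.piFinset_univ, Fintype.sum_bool] at h
  simp only [ex, ← Finset.prod_mul_distrib]
  rw [← h]
  simp

lemma ex_const (q : ι → ℝ) (c : ℝ) : ex q (fun _ => c) = c := by
  have h := ex_prod q (fun _ _ => 1)
  simp [ex] at h
  simp [ex, ← Finset.sum_mul, h]

lemma ex_add (f g : (ι → Bool) → ℝ) : ex q (fun ω => f ω + g ω) = ex q f + ex q g := by
  simp [ex, mul_add, Finset.sum_add_distrib]

lemma ex_mul_left (c : ℝ) (f : (ι → Bool) → ℝ) : ex q (fun ω => c * f ω) = c * ex q f := by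
  simp only [ex, Finset.mul_sum]
  exact Finset.sum_congr rfl fun _ _ => by ring

lemma ex_sum {κ : Type*} (s : Finset κ) (f : κ → (ι → Bool) → ℝ) :
    ex q (fun ω => ∑ x ∈ s, f x ω) = ∑ x ∈ s, ex q (f x) := by
  simp only [ex, Finset.mul_sum]
  exact Finset.sum_comm

lemma weight_nonneg (hq : ∀ e, 0 ≤ q e ∧ q e ≤ 1) (ω : ι → Bool) :
    0 ≤ ∏ e, if ω e then q e else 1 - q e :=
  Finset.prod_nonneg fun e _ => by
    split_ifs
    · exact (hq e).1
    · linarith [(hq e).2]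

lemma ex_mono (hq : ∀ e, 0 ≤ q e ∧ q e ≤ 1) {f g : (ι → Bool) → ℝ} (h : ∀ ω, f ω ≤ g ω) :
    ex q f ≤ ex q g :=
  Finset.sum_le_sum fun ω _ => mul_le_mul_of_nonneg_left (h ω) (weight_nonneg hq ω)

lemma ex_nonneg (hq : ∀ e, 0 ≤ q e ∧ q e ≤ 1) {f : (ι → Bool) → ℝ} (h : ∀ ω, 0 ≤ f ω) :
    0 ≤ ex q f :=
  Finset.sum_nonneg fun ω _ => mul_nonneg (weight_nonneg hq ω) (h ω)

lemma pr_nonneg (hq : ∀ e, 0 ≤ q e ∧ q e ≤ 1) (Q : (ι → Bool) → Prop) : 0 ≤ pr q Q :=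
  ex_nonneg hq fun ω => by split_ifs <;> norm_num

lemma pr_mono (hq : ∀ e, 0 ≤ q e ∧ q e ≤ 1) {Q R : (ι → Bool) → Prop} (h : ∀ ω, Q ω → R ω) :
    pr q Q ≤ pr q R :=
  ex_mono hq fun ω => by
    by_cases hQ : Q ω
    · simp [hQ, h ω hQ]
    · simp only [hQ, if_false]
      split_ifs <;> norm_num

lemma pr_le_one (hq : ∀ e, 0 ≤ q e ∧ q e ≤ 1) (Q : (ι → Bool) → Prop) : pr q Q ≤ 1 := by
  rw [← ex_const q 1]
  exact ex_mono hq fun ω => by split_ifs <;> norm_num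

lemma pr_not (q : ι → ℝ) (Q : (ι → Bool) → Prop) : pr q (fun ω => ¬ Q ω) = 1 - pr q Q := by
  rw [eq_sub_iff_add_eq, ← ex_const q 1, pr, pr, ← ex_add]
  congr 1
  funext ω
  by_cases h : Q ω <;> simp [h]

lemma pr_exists_le (hq : ∀ e, 0 ≤ q e ∧ q e ≤ 1) {κ : Type*} [Fintype κ]
    (Q : κ → (ι → Bool) → Prop) : pr q (fun ω => ∃ x, Q x ω) ≤ ∑ x, pr q (Q x) := by
  simp only [pr]
  rw [← ex_sum]
  refine ex_mono hq fun ω => ?_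
  have h0 : ∀ x, (0 : ℝ) ≤ if Q x ω then 1 else 0 := fun x => by split_ifs <;> norm_num
  split_ifs with h
  · obtain ⟨x, hx⟩ := h
    calc (1 : ℝ) = if Q x ω then 1 else 0 := by simp [hx]
      _ ≤ _ := Finset.single_le_sum (f := fun x => if Q x ω then (1 : ℝ) else 0)
        (fun x _ => h0 x) (Finset.mem_univ x)
  · exact Finset.sum_nonneg fun x _ => h0 x

lemma pr_or_le (hq : ∀ e, 0 ≤ q e ∧ q e ≤ 1) (Q R : (ι → Bool) → Prop) :
    pr q (fun ω => Q ω ∨ R ω) ≤ pr q Q + pr q R := by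
  simp only [pr]
  rw [← ex_add]
  refine ex_mono hq fun ω => ?_
  by_cases h1 : Q ω <;> by_cases h2 : R ω <;> simp [h1, h2]

lemma mul_pr_le_ex (hq : ∀ e, 0 ≤ q e ∧ q e ≤ 1) {f : (ι → Bool) → ℝ} (h : ∀ ω, 0 ≤ f ω)
    {c : ℝ} : c * pr q (fun ω => c ≤ f ω) ≤ ex q f := by
  rw [pr, ← ex_mul_left]
  refine ex_mono hq fun ω => ?_
  split_ifs with hc
  · simpa using hc
  · simpa using h ω

/-- A lower bound for the upper tail of a variable from its second moment. -/
lemma sq_le_ex_sq_mul_pr (hq : ∀ e, 0 ≤ q e ∧ q e ≤ 1) {f : (ι → Bool) → ℝ}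
    {c : ℝ} (hc : 0 ≤ c) (h2 : 2 * c ≤ ex q f) :
    c ^ 2 ≤ ex q (fun ω => f ω ^ 2) * pr q (fun ω => c ≤ f ω) := by
  have h1 : c ≤ ex q (fun ω => f ω * if c ≤ f ω then 1 else 0) := by
    have : ex q f ≤ ex q (fun ω => c + f ω * if c ≤ f ω then 1 else 0) :=
      ex_mono hq fun ω => by
        split_ifs with hω
        · linarith
        · linarith
    rw [ex_add, ex_const] at this
    linarith
  refine (pow_le_pow_left₀ hc h1 2).trans ?_
  simp only [pr, ex]
  refine Finset.sum_sq_le_sum_mul_sum_of_sq_le_mul _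
    (fun ω _ => mul_nonneg (weight_nonneg hq ω) (sq_nonneg _))
    (fun ω _ => mul_nonneg (weight_nonneg hq ω) (by split_ifs <;> norm_num))
    fun ω _ => le_of_eq ?_
  split_ifs <;> ring

/-- Functions depending on disjoint sets of coordinates are independent. -/
lemma ex_mul_of_disjoint (q : ι → ℝ) (F : Set ι) {f g : (ι → Bool) → ℝ}
    (hf : ∀ ω ω', (∀ e ∈ F, ω e = ω' e) → f ω = f ω')
    (hg : ∀ ω ω', (∀ e ∉ F, ω e = ω' e) → g ω = g ω') :
    ex q (fun ω => f ω * g ω) = ex q f * ex q g := by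
  let Φ := (Equiv.piEquivPiSubtypeProd (fun e => e ∈ F) (fun _ : ι => Bool)).symm
  let a : ({e // e ∈ F} → Bool) → ℝ := fun x => ∏ e, if x e then q e.1 else 1 - q e.1
  let b : ({e // e ∉ F} → Bool) → ℝ := fun x => ∏ e, if x e then q e.1 else 1 - q e.1
  have hw : ∀ x y, (∏ e, if Φ (x, y) e then q e else 1 - q e) = a x * b y := fun x y => by
    rw [← Fintype.prod_subtype_mul_prod_subtype (fun e => e ∈ F)]
    congr 1
    · exact Finset.prod_congr rfl fun e _ => by
        simp [Φ, Equiv.piEquivPiSubtypeProd, e.2]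
    · exact Finset.prod_congr rfl fun e _ => by
        simp [Φ, Equiv.piEquivPiSubtypeProd, e.2]
  have key : ∀ h : (ι → Bool) → ℝ, ex q h = ∑ x, ∑ y, a x * b y * h (Φ (x, y)) := fun h => by
    rw [ex, ← Φ.sum_comp, Fintype.sum_prod_type]
    simp only [hw]
  let y₀ : {e // e ∉ F} → Bool := fun _ => true
  let x₀ : {e // e ∈ F} → Bool := fun _ => true
  have hf' : ∀ x y, f (Φ (x, y)) = f (Φ (x, y₀)) := fun x y => hf _ _ fun e he => by
    simp [Φ, Equiv.piEquivPiSubtypeProd, he]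
  have hg' : ∀ x y, g (Φ (x, y)) = g (Φ (x₀, y)) := fun x y => hg _ _ fun e he => by
    simp [Φ, Equiv.piEquivPiSubtypeProd, he]
  have h1 := ex_const q 1
  rw [key] at h1
  have e1 : ex q f = (∑ x, a x * f (Φ (x, y₀))) * ∑ y, b y := by
    rw [key, Finset.sum_mul_sum]
    exact Finset.sum_congr rfl fun x _ => Finset.sum_congr rfl fun y _ => by
      rw [hf' x y]; ring
  have e2 : ex q g = (∑ x, a x) * ∑ y, b y * g (Φ (x₀, y)) := by
    rw [key, Finset.sum_mul_sum]
    exact Finset.sum_congr rfl fun x _ => Finset.sum_congr rfl fun y _ => by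
      rw [hg' x y]; ring
  have e3 : ex q (fun ω => f ω * g ω) =
      (∑ x, a x * f (Φ (x, y₀))) * ∑ y, b y * g (Φ (x₀, y)) := by
    rw [key, Finset.sum_mul_sum]
    exact Finset.sum_congr rfl fun x _ => Finset.sum_congr rfl fun y _ => by
      rw [hg' x y, hf' x y]; ring
  have e4 : (∑ x, a x) * ∑ y, b y = 1 := by
    rw [← h1, Finset.sum_mul_sum]
    simp
  rw [e1, e2, e3]
  linear_combination (-(∑ x, a x * f (Φ (x, y₀))) * ∑ y, b y * g (Φ (x₀, y))) * e4

/-- If each of `L` events depending on pairwise disjoint sets of coordinates has probability at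
most `c`, then all of them hold with probability at most `c ^ L`. -/
lemma pr_forall_le_pow (hq : ∀ e, 0 ≤ q e ∧ q e ≤ 1) (L : ℕ) (F : ℕ → Set ι)
    (hF : ∀ i j, i ≠ j → Disjoint (F i) (F j)) (Q : ℕ → (ι → Bool) → Prop)
    (hQ : ∀ i ω ω', (∀ e ∈ F i, ω e = ω' e) → (Q i ω ↔ Q i ω')) {c : ℝ}
    (hc : ∀ i < L, pr q (Q i) ≤ c) :
    pr q (fun ω => ∀ i < L, Q i ω) ≤ c ^ L := by
  induction L with
  | zero => simpa using pr_le_one hq _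
  | succ L ih =>
    have h1 : pr q (fun ω => ∀ i < L + 1, Q i ω) =
        pr q (Q L) * pr q (fun ω => ∀ i < L, Q i ω) := by
      simp only [pr]
      rw [← ex_mul_of_disjoint q (F L)]
      · congr 1
        funext ω
        have h0 : (∀ i < L + 1, Q i ω) ↔ (∀ i < L, Q i ω) ∧ Q L ω := Nat.forall_lt_succ_right
        simp only [h0]
        by_cases h2 : Q L ω <;> by_cases h3 : ∀ i < L, Q i ω <;> simp only [h2, h3] <;> simp
      · intro ω ω' h
        simp [hQ L ω ω' h]
      · intro ω ω' h
        have : (∀ i < L, Q i ω) ↔ ∀ i < L, Q i ω' := by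
          refine forall₂_congr fun i hi => hQ i ω ω' fun e he => h e fun he' => ?_
          exact Set.disjoint_left.1 (hF i L hi.ne) he he'
        simp [this]
    rw [h1, pow_succ']
    exact mul_le_mul (hc L (Nat.lt_succ_self L)) (ih fun i hi => hc i (hi.trans (Nat.lt_succ_self L)))
      (pr_nonneg hq _) ((pr_nonneg hq _).trans (hc L (Nat.lt_succ_self L)))

/-- The probability of a cylinder. -/
lemma pr_cylinder (q : ι → ℝ) (F : Finset ι) (x : ι → Bool) :
    pr q (fun ω => ∀ e ∈ F, ω e = x e) = ∏ e ∈ F, if x e then q e else 1 - q e := by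
  have h := ex_prod q (fun e b => if e ∈ F then (if b = x e then 1 else 0) else 1)
  have h2 : (fun ω : ι → Bool => ∏ e, if e ∈ F then (if ω e = x e then (1 : ℝ) else 0) else 1) =
      fun ω => if ∀ e ∈ F, ω e = x e then 1 else 0 := by
    funext ω
    rw [Finset.prod_ite_mem, Finset.univ_inter, Finset.prod_boole]
    split_ifs <;> rfl
  rw [h2] at h
  refine Eq.trans ?_ (h.trans ?_)
  · simp only [pr]
    congr! 3
  rw [← Finset.prod_subset (Finset.subset_univ F)]
  · refine Finset.prod_congr rfl fun e he => ?_
    cases hx : x e <;> simp [he]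
  · intro e _ he
    simp [he]

end FiniteProbability

section Hypergraphs

variable {V V' : Type*} [Fintype V] [Fintype V']

/-- The relations of `H` that hold on subsets of `X`. -/
noncomputable def edg (H : Fin p × Finset V → Bool) (X : Finset V) :
    Finset (Fin p × Finset V) :=
  Finset.univ.filter fun e => H e = true ∧ e.2 ⊆ X

/-- The predimension of `X` in the hypergraph `H`. -/
noncomputable def dl (α : Fin p → ℝ) (H : Fin p × Finset V → Bool) (X : Finset V) : ℝ :=
  X.card - ∑ e ∈ edg H X, α e.1

/-- The action of a map of vertices on potential relations. -/
noncomputable def push {V V' : Type*} (g : V → V') (e : Fin p × Finset V) : Fin p × Finset V' :=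
  (e.1, e.2.image g)

/-- `g` is an isomorphism of `H` onto an induced subhypergraph of `G`. -/
def IsEmbed (H : Fin p × Finset V → Bool) (G : Fin p × Finset V' → Bool) (g : V → V') : Prop :=
  Function.Injective g ∧ ∀ e, G (push g e) = H e

/-- Every proper extension of `X` by at most `t` vertices has larger predimension. -/
def Strong (α : Fin p → ℝ) (G : Fin p × Finset V → Bool) (t : ℕ) (X : Finset V) : Prop :=
  ∀ Y, X ⊂ Y → (Y \ X).card ≤ t → dl α G X < dl α G Y

/-- Every proper extension of `A` has larger predimension. -/
def Safe (α : Fin p → ℝ) (H : Fin p × Finset V → Bool) (A : Finset V) : Prop :=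
  ∀ Y, A ⊂ Y → dl α H A < dl α H Y

lemma mem_edg {H : Fin p × Finset V → Bool} {X : Finset V} {e : Fin p × Finset V} :
    e ∈ edg H X ↔ H e = true ∧ e.2 ⊆ X := by
  simp [edg]

lemma edg_mono (H : Fin p × Finset V → Bool) {X Y : Finset V} (h : X ⊆ Y) :
    edg H X ⊆ edg H Y := fun _ he =>
  mem_edg.2 ⟨(mem_edg.1 he).1, (mem_edg.1 he).2.trans h⟩

lemma push_injective {V V' : Type*} {g : V → V'} (hg : Function.Injective g) :
    Function.Injective (push (p := p) g) := fun e e' h => by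
  have h1 : (push g e).1 = (push g e').1 := congrArg Prod.fst h
  have h2 : (push g e).2 = (push g e').2 := congrArg Prod.snd h
  exact Prod.ext h1 (Finset.image_injective hg h2)

lemma push_comp {V V' V'' : Type*} (g : V' → V'') (f : V → V') (e : Fin p × Finset V) :
    push (g ∘ f) e = push g (push f e) := by
  simp [push, Finset.image_image]

lemma edg_image {H : Fin p × Finset V → Bool} {G : Fin p × Finset V' → Bool} {g : V → V'}
    (hg : IsEmbed H G g) (X : Finset V) : edg G (X.image g) = (edg H X).image (push g) := by
  ext e
  simp only [mem_edg, Finset.mem_image]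
  constructor
  · rintro ⟨h1, h2⟩
    obtain ⟨C, hC, hCe⟩ := Finset.subset_image_iff.1 h2
    have he : push g (e.1, C) = e := Prod.ext rfl hCe
    exact ⟨(e.1, C), ⟨by rw [← hg.2, he, h1], by exact_mod_cast hC⟩, he⟩
  · rintro ⟨e', ⟨h1, h2⟩, rfl⟩
    exact ⟨by rw [hg.2, h1], Finset.image_subset_image h2⟩

lemma dl_image (α : Fin p → ℝ) {H : Fin p × Finset V → Bool} {G : Fin p × Finset V' → Bool}
    {g : V → V'} (hg : IsEmbed H G g) (X : Finset V) : dl α G (X.image g) = dl α H X := by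
  rw [dl, dl, edg_image hg, Finset.sum_image (push_injective hg.1).injOn,
    Finset.card_image_of_injective _ hg.1]
  rfl

lemma dl_sub (α : Fin p → ℝ) (H : Fin p × Finset V → Bool) {X Y : Finset V} (h : X ⊆ Y) :
    dl α H Y - dl α H X = (Y \ X).card - ∑ e ∈ edg H Y \ edg H X, α e.1 := by
  have h1 := Finset.sum_sdiff (edg_mono H h) (f := fun e => α e.1)
  have h2 : ((Y \ X).card : ℝ) = Y.card - X.card := by
    rw [Finset.card_sdiff_of_subset h, Nat.cast_sub (Finset.card_le_card h)]
  rw [dl, dl, h2]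
  linarith

lemma dl_le_card {α : Fin p → ℝ} (hα : ∀ i, 0 < α i) (H : Fin p × Finset V → Bool)
    (X : Finset V) : dl α H X ≤ X.card := by
  have : 0 ≤ ∑ e ∈ edg H X, α e.1 := Finset.sum_nonneg fun e _ => (hα e.1).le
  rw [dl]
  linarith

lemma sum_eq_sum_mul_count {V : Type*} (α : Fin p → ℝ) (S : Finset (Fin p × Finset V)) :
    ∑ e ∈ S, α e.1 = ∑ i, ((S.filter fun e => e.1 = i).card : ℝ) * α i := by
  rw [← Finset.sum_fiberwise S (fun e => e.1)]
  refine Finset.sum_congr rfl fun i _ => ?_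
  have h : ∀ e ∈ S.filter fun e => e.1 = i, α e.1 = α i := fun e he => by
    rw [(Finset.mem_filter.1 he).2]
  rw [Finset.sum_congr rfl h]
  simp

/-- Under the irrationality hypothesis the predimension determines the cardinality. -/
lemma card_eq_of_dl_eq {α : Fin p → ℝ} (hirr : IrrHyp α) {H : Fin p × Finset V → Bool}
    {G : Fin p × Finset V' → Bool} {X : Finset V} {Y : Finset V'}
    (h : dl α H X = dl α G Y) : X.card = Y.card := by
  have h1 := Fintype.linearIndependent_iff.1 hirr
    (Fin.snoc (fun i => (((edg H X).filter fun e => e.1 = i).card : ℚ) -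
      ((edg G Y).filter fun e => e.1 = i).card) ((Y.card : ℚ) - X.card) : Fin (p + 1) → ℚ) ?_
    (Fin.last p)
  · rw [Fin.snoc_last, sub_eq_zero] at h1
    exact_mod_cast h1.symm
  · rw [Fin.sum_univ_castSucc]
    simp only [Fin.snoc_castSucc, Fin.snoc_last, Rat.smul_def]
    push_cast
    simp only [sub_mul, Finset.sum_sub_distrib]
    rw [dl, dl, sum_eq_sum_mul_count, sum_eq_sum_mul_count] at h
    linarith

/-- Negative values of `v - ∑ w i * α i` with `v ≤ t` are bounded away from zero. -/
lemma exists_gap {α : Fin p → ℝ} (hα : ∀ i, 0 < α i) (t : ℕ) :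
    ∃ ε : ℝ, 0 < ε ∧ ∀ v : ℕ, v ≤ t → ∀ w : Fin p → ℕ, (v : ℝ) - ∑ i, (w i : ℝ) * α i < 0 →
      (v : ℝ) - ∑ i, (w i : ℝ) * α i ≤ -ε := by
  let T : Set ℝ := {x | 0 < x ∧ x ≤ 1 ∧ ∃ v ≤ t, ∃ w : Fin p → ℕ,
    x = ∑ i, (w i : ℝ) * α i - v}
  have hT : T.Finite := by
    refine Set.Finite.subset (((Set.finite_Iic t).prod
      (Set.finite_Iic (fun i => ⌈((t : ℝ) + 1) / α i⌉₊ : Fin p → ℕ))).image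
        fun z => ∑ i, (z.2 i : ℝ) * α i - z.1) ?_
    rintro x ⟨h0, h1, v, hv, w, rfl⟩
    refine ⟨(v, w), ⟨hv, fun i => ?_⟩, rfl⟩
    have h2 : (w i : ℝ) * α i ≤ ∑ i, (w i : ℝ) * α i :=
      Finset.single_le_sum (f := fun i => (w i : ℝ) * α i)
        (fun i _ => mul_nonneg (Nat.cast_nonneg _) (hα i).le) (Finset.mem_univ i)
    have hv' : (v : ℝ) ≤ t := Nat.cast_le.2 hv
    have h3 : (w i : ℝ) ≤ ((t : ℝ) + 1) / α i := by
      rw [le_div_iff₀ (hα i)]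
      linarith
    exact_mod_cast h3.trans (Nat.le_ceil _)
  by_cases hne : T.Nonempty
  · obtain ⟨ε, hε, hmin⟩ := Set.exists_min_image T id hT hne
    refine ⟨ε, hε.1, fun v hv w hw => ?_⟩
    by_cases h1 : ∑ i, (w i : ℝ) * α i - v ≤ 1
    · have := hmin (∑ i, (w i : ℝ) * α i - v) ⟨by linarith, h1, v, hv, w, rfl⟩
      simp only [id] at this
      linarith
    · have := hε.2.1
      linarith
  · refine ⟨1, one_pos, fun v hv w hw => ?_⟩
    by_contra h
    exact hne ⟨∑ i, (w i : ℝ) * α i - v, by linarith, by linarith, v, hv, w, rfl⟩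

/-- Every set of at most `s` vertices lies in a strong set of bounded size, as long as bounded
sets have nonnegative predimension. -/
lemma exists_strong_superset {α : Fin p → ℝ} (hα : ∀ i, 0 < α i) (hirr : IrrHyp α) (s t : ℕ) :
    ∃ S : ℕ, ∀ (V : Type) [Fintype V] (G : Fin p × Finset V → Bool),
      (∀ X : Finset V, X.card ≤ S → 0 ≤ dl α G X) →
      ∀ X : Finset V, X.card ≤ s → ∃ Y, X ⊆ Y ∧ Y.card ≤ S ∧ Strong α G t Y := by
  obtain ⟨ε, hε, hgap⟩ := exists_gap hα t
  let c : ℝ := ε / (t + 1)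
  have hc : 0 < c := by positivity
  have hct : c * t < ε := by
    have : c * (t + 1) = ε := by simp only [c]; field_simp
    linarith
  let K : ℕ := ⌈(s : ℝ) + s / c⌉₊
  refine ⟨K + t, fun V _ G hG X hX => ?_⟩
  have hsK : (s : ℝ) + s / c ≤ K := Nat.le_ceil _
  have hsc : 0 ≤ (s : ℝ) / c := by positivity
  have hXs : (X.card : ℝ) ≤ s := Nat.cast_le.2 hX
  have hXK : X.card ≤ K + t := by
    have : (X.card : ℝ) ≤ K := by linarith
    have : X.card ≤ K := by exact_mod_cast this
    omega
  obtain ⟨Y, hY, hmin⟩ := Finset.exists_min_image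
    (Finset.univ.filter fun Y : Finset V => X ⊆ Y ∧ Y.card ≤ K + t)
    (fun Y => dl α G Y + c * Y.card) ⟨X, by simp [hXK]⟩
  simp only [Finset.mem_filter, Finset.mem_univ, true_and] at hY hmin
  refine ⟨Y, hY.1, hY.2, fun Z hYZ hZ => ?_⟩
  by_contra hlt
  push Not at hlt
  have hYK : Y.card ≤ K := by
    have h1 := hmin X ⟨subset_rfl, hXK⟩
    have h2 := hG Y hY.2
    have h3 := dl_le_card hα G X
    have h4 : c * X.card ≤ c * s := mul_le_mul_of_nonneg_left hXs hc.le
    have h5 : (Y.card : ℝ) ≤ s + s / c := by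
      have : (s : ℝ) + s / c = (s + c * s) / c := by field_simp; ring
      rw [this, le_div_iff₀ hc]
      linarith
    exact_mod_cast h5.trans hsK
  have hcard : Z.card = Y.card + (Z \ Y).card := by
    rw [Finset.card_sdiff_of_subset hYZ.1]
    have := Finset.card_le_card hYZ.1
    omega
  have hne : dl α G Z ≠ dl α G Y := fun h =>
    (Finset.card_lt_card hYZ).ne' (card_eq_of_dl_eq hirr h)
  have h1 := hmin Z ⟨hY.1.trans hYZ.1, by omega⟩
  have h2 := dl_sub α G hYZ.1
  rw [sum_eq_sum_mul_count] at h2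
  have h3 := hgap _ hZ _ (h2 ▸ sub_neg.2 (lt_of_le_of_ne hlt hne))
  rw [← h2] at h3
  have h4 : (Z.card : ℝ) ≤ Y.card + t := by exact_mod_cast (by omega : Z.card ≤ Y.card + t)
  have h5 : c * Z.card ≤ c * (Y.card + t) := mul_le_mul_of_nonneg_left h4 hc.le
  linarith

lemma Strong.mono {α : Fin p → ℝ} {G : Fin p × Finset V → Bool} {t t' : ℕ} {X : Finset V}
    (h : Strong α G t X) (ht : t' ≤ t) : Strong α G t' X := fun Y hY hc => h Y hY (hc.trans ht)

/-- A strong set is safe inside every small induced subhypergraph. -/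
lemma Strong.safe {α : Fin p → ℝ} {H : Fin p × Finset V → Bool} {G : Fin p × Finset V' → Bool}
    {t : ℕ} {g : V → V'} (hg : IsEmbed H G g) {A : Finset V} (h : Strong α G t (A.image g))
    (ht : Fintype.card V ≤ A.card + t) : Safe α H A := fun Y hY => by
  rw [← dl_image α hg, ← dl_image α hg]
  refine h _ ((Finset.image_ssubset_image hg.1).2 hY) ?_
  rw [Finset.card_sdiff_of_subset (Finset.image_subset_image hY.1),
    Finset.card_image_of_injective _ hg.1, Finset.card_image_of_injective _ hg.1]
  have := Finset.card_le_univ Y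
  omega

lemma dl_union_add_dl_inter_le {α : Fin p → ℝ} (hα : ∀ i, 0 < α i) (H : Fin p × Finset V → Bool)
    (X Y : Finset V) : dl α H (X ∪ Y) + dl α H (X ∩ Y) ≤ dl α H X + dl α H Y := by
  have h1 : edg H (X ∩ Y) = edg H X ∩ edg H Y := by
    ext e
    simp only [Finset.mem_inter, mem_edg, Finset.subset_inter_iff]
    tauto
  have h2 : edg H X ∪ edg H Y ⊆ edg H (X ∪ Y) :=
    Finset.union_subset (edg_mono H Finset.subset_union_left)
      (edg_mono H Finset.subset_union_right)
  have h3 := Finset.sum_le_sum_of_subset_of_nonneg (f := fun e => α e.1) h2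
    fun e _ _ => (hα e.1).le
  have h4 := Finset.sum_union_inter (s₁ := edg H X) (s₂ := edg H Y) (f := fun e => α e.1)
  have h5 : ((X ∪ Y).card : ℝ) + (X ∩ Y).card = X.card + Y.card := by
    exact_mod_cast Finset.card_union_add_card_inter X Y
  simp only [dl, h1]
  linarith

/-- A copy of a strong set inside a strong copy of a surrounding hypergraph is strong. -/
lemma Strong.image_of_isEmbed {α : Fin p → ℝ} (hα : ∀ i, 0 < α i) {W : Type*} [Fintype W]
    {H : Fin p × Finset W → Bool} {G : Fin p × Finset V → Bool} {G' : Fin p × Finset V' → Bool}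
    {t : ℕ} {h : W → V} {g : W → V'} (hh : IsEmbed H G h) (hg : IsEmbed H G' g) {B : Finset W}
    (hB : Strong α G t (B.image h)) (hs : Strong α G' t (Finset.univ.image g)) :
    Strong α G' t (B.image g) := fun Z hZ hZt => by
  let C : Finset W := Finset.univ.filter fun w => g w ∈ Z
  have hC : C.image g = Z ∩ Finset.univ.image g := by
    ext z
    simp only [C, Finset.mem_image, Finset.mem_filter, Finset.mem_univ, true_and,
      Finset.mem_inter]
    constructor
    · rintro ⟨w, hw, rfl⟩
      exact ⟨hw, w, rfl⟩
    · rintro ⟨hz, w, rfl⟩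
      exact ⟨w, hz, rfl⟩
  have hBC : B ⊆ C := fun w hw => by
    simpa [C] using hZ.1 (Finset.mem_image_of_mem g hw)
  have h1 := dl_union_add_dl_inter_le hα G' Z (Finset.univ.image g)
  rw [← hC, dl_image α hg] at h1
  have h2 : Z ∪ Finset.univ.image g ≠ Finset.univ.image g →
      dl α G' (Finset.univ.image g) < dl α G' (Z ∪ Finset.univ.image g) := fun hne =>
    hs _ (Finset.subset_union_right.ssubset_of_ne hne.symm) <| by
      rw [Finset.union_sdiff_right]
      exact (Finset.card_le_card (Finset.sdiff_subset_sdiff le_rfl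
        (Finset.image_subset_image (Finset.subset_univ B)))).trans hZt
  have h3 : B ≠ C → dl α H B < dl α H C := fun hne => by
    rw [← dl_image α hh, ← dl_image α hh]
    refine hB _ ((Finset.image_ssubset_image hh.1).2 (hBC.ssubset_of_ne hne)) ?_
    rw [Finset.card_sdiff_of_subset (Finset.image_subset_image hBC),
      Finset.card_image_of_injective _ hh.1, Finset.card_image_of_injective _ hh.1]
    refine le_trans ?_ hZt
    rw [Finset.card_sdiff_of_subset hZ.1, Finset.card_image_of_injective _ hg.1]
    refine Nat.sub_le_sub_right ?_ _
    rw [← Finset.card_image_of_injective C hg.1, hC]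
    exact Finset.card_le_card Finset.inter_subset_left
  rw [dl_image α hg]
  by_cases h4 : B = C
  · have h5 : Z ∪ Finset.univ.image g ≠ Finset.univ.image g := fun h5 => by
      rw [Finset.inter_eq_left.2 (Finset.union_eq_right.1 h5), ← h4] at hC
      exact hZ.ne hC
    rw [← h4] at h1
    linarith [h2 h5]
  · by_cases h5 : Z ∪ Finset.univ.image g = Finset.univ.image g
    · rw [h5] at h1
      linarith [h3 h4]
    · linarith [h2 h5, h3 h4]

end Hypergraphs

section Moments

variable {U V : Type} [Fintype U] [Fintype V]

/-- The product of the probabilities `r` of the potential relations in `S`. -/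
noncomputable def wt {V : Type*} (r : Fin p → ℝ) (S : Finset (Fin p × Finset V)) : ℝ :=
  ∏ e ∈ S, r e.1

/-- The relations of `H` on subsets of `Z` which are not relations on subsets of `A`. -/
noncomputable def relEdg (H : Fin p × Finset U → Bool) (A Z : Finset U) :
    Finset (Fin p × Finset U) :=
  edg H Z \ edg H A

/-- Injective maps that agree with `f` on `A` and map each `x ∉ A` into `W x`. -/
noncomputable def copies (f : U → V) (A : Finset U) (W : U → Finset V) : Finset (U → V) :=
  Finset.univ.filter fun g =>
    Function.Injective g ∧ (∀ x ∈ A, g x = f x) ∧ ∀ x, x ∉ A → g x ∈ W x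

/-- The number of members of `copies f A W` that carry all the relations of `H` over `A`. -/
noncomputable def numPos (H : Fin p × Finset U → Bool) (f : U → V) (A : Finset U)
    (W : U → Finset V) (ω : Fin p × Finset V → Bool) : ℝ :=
  ∑ g ∈ copies f A W,
    if ∀ e ∈ (relEdg H A Finset.univ).image (push g), ω e = true then 1 else 0

lemma numPos_nonneg (H : Fin p × Finset U → Bool) (f : U → V) (A : Finset U)
    (W : U → Finset V) (ω : Fin p × Finset V → Bool) : 0 ≤ numPos H f A W ω :=
  Finset.sum_nonneg fun g _ => by split_ifs <;> norm_num

lemma wt_pos {V : Type*} {r : Fin p → ℝ} (hr : ∀ i, 0 < r i ∧ r i ≤ 1)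
    (S : Finset (Fin p × Finset V)) : 0 < wt r S :=
  Finset.prod_pos fun e _ => (hr e.1).1

lemma wt_le_one {V : Type*} {r : Fin p → ℝ} (hr : ∀ i, 0 < r i ∧ r i ≤ 1)
    (S : Finset (Fin p × Finset V)) : wt r S ≤ 1 :=
  Finset.prod_le_one (fun e _ => (hr e.1).1.le) fun e _ => (hr e.1).2

lemma wt_sdiff_mul {V : Type*} (r : Fin p → ℝ) {S S' : Finset (Fin p × Finset V)}
    (h : S ⊆ S') : wt r (S' \ S) * wt r S = wt r S' :=
  Finset.prod_sdiff h

lemma wt_anti {V : Type*} {r : Fin p → ℝ} (hr : ∀ i, 0 < r i ∧ r i ≤ 1)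
    {S S' : Finset (Fin p × Finset V)} (h : S ⊆ S') : wt r S' ≤ wt r S := by
  rw [← wt_sdiff_mul r h]
  exact mul_le_of_le_one_left (wt_pos hr S).le (wt_le_one hr _)

lemma wt_image_push {U V : Type*} (r : Fin p → ℝ) {g : U → V} (hg : Function.Injective g)
    (S : Finset (Fin p × Finset U)) : wt r (S.image (push g)) = wt r S := by
  rw [wt, Finset.prod_image (push_injective hg).injOn]
  rfl

lemma mem_relEdg {H : Fin p × Finset U → Bool} {A Z : Finset U} {e : Fin p × Finset U} :
    e ∈ relEdg H A Z ↔ H e = true ∧ e.2 ⊆ Z ∧ ¬ e.2 ⊆ A := by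
  simp only [relEdg, Finset.mem_sdiff, mem_edg]
  tauto

lemma wt_union_image_le {V : Type*} {r : Fin p → ℝ} (hr : ∀ i, 0 < r i ∧ r i ≤ 1)
    (H : Fin p × Finset U → Bool) (A : Finset U) {g : U → V} (hg : Function.Injective g)
    {S : Finset (Fin p × Finset V)} {T : Finset V} (hS : ∀ e ∈ S, e.2 ⊆ T) {Z : Finset U}
    (hZ : ∀ x, g x ∈ T → x ∈ Z) :
    wt r (S ∪ (relEdg H A Finset.univ).image (push g)) * wt r (relEdg H A Z) ≤
      wt r S * wt r (relEdg H A Finset.univ) := by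
  have hsub : relEdg H A Z ⊆ relEdg H A Finset.univ := fun e he => by
    rw [mem_relEdg] at he ⊢
    exact ⟨he.1, Finset.subset_univ _, he.2.2⟩
  rw [← wt_sdiff_mul r hsub, ← mul_assoc]
  refine mul_le_mul_of_nonneg_right ?_ (wt_pos hr _).le
  rw [← wt_image_push r hg (_ \ _)]
  have hd : Disjoint S ((relEdg H A Finset.univ \ relEdg H A Z).image (push g)) := by
    rw [Finset.disjoint_left]
    intro e he he'
    obtain ⟨e', h1, rfl⟩ := Finset.mem_image.1 he'
    rw [Finset.mem_sdiff, mem_relEdg, mem_relEdg] at h1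
    refine h1.2 ⟨h1.1.1, fun x hx => hZ x ?_, h1.1.2.2⟩
    exact hS _ he (Finset.mem_image_of_mem g hx)
  have h2 : wt r S * wt r ((relEdg H A Finset.univ \ relEdg H A Z).image (push g)) =
      wt r (S ∪ (relEdg H A Finset.univ \ relEdg H A Z).image (push g)) :=
    (Finset.prod_union hd).symm
  rw [h2]
  exact wt_anti hr (Finset.union_subset_union_right (Finset.image_subset_image Finset.sdiff_subset))

lemma card_copies_fiber_mul_le (f : U → V) (A : Finset U) (W : U → Finset V) {m : ℝ}
    (hm : 0 ≤ m) (hW : ∀ x, ((W x).card : ℝ) ≤ m) (T : Finset V) {Z : Finset U} :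
    (((copies f A W).filter fun g => A ∪ (Finset.univ.filter fun x => g x ∈ T) = Z).card : ℝ) *
      m ^ (Z \ A).card ≤ ((T.card : ℝ) + 1) ^ Fintype.card U * m ^ Aᶜ.card := by
  have h1 : ((copies f A W).filter fun g =>
      A ∪ (Finset.univ.filter fun x => g x ∈ T) = Z) ⊆
      Fintype.piFinset fun x => if x ∈ A then {f x} else if x ∈ Z then T else W x := by
    intro g hg
    simp only [copies, Finset.mem_filter, Finset.mem_univ, true_and] at hg
    obtain ⟨⟨-, h2, h3⟩, rfl⟩ := hg
    rw [Fintype.mem_piFinset]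
    intro x
    by_cases hxA : x ∈ A
    · simp [hxA, h2 x hxA]
    · by_cases hxT : g x ∈ T
      · simp [hxA, hxT]
      · simp [hxA, hxT, h3 x hxA]
  have h2 : (((copies f A W).filter fun g =>
      A ∪ (Finset.univ.filter fun x => g x ∈ T) = Z).card : ℝ) ≤
      ∏ x, if x ∈ A then 1 else if x ∈ Z then (T.card : ℝ) + 1 else m := by
    refine (Nat.cast_le.2 (Finset.card_le_card h1)).trans ?_
    rw [Fintype.card_piFinset, Nat.cast_prod]
    refine Finset.prod_le_prod (fun x _ => Nat.cast_nonneg _) fun x _ => ?_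
    split_ifs
    · simp
    · linarith
    · exact hW x
  have h3 : m ^ (Z \ A).card = ∏ x, if x ∈ Z \ A then m else 1 := by
    rw [Finset.prod_ite_mem, Finset.univ_inter, Finset.prod_const]
  have h4 : m ^ Aᶜ.card = ∏ x, if x ∈ Aᶜ then m else 1 := by
    rw [Finset.prod_ite_mem, Finset.univ_inter, Finset.prod_const]
  have h5 : ((T.card : ℝ) + 1) ^ Fintype.card U = ∏ _x : U, ((T.card : ℝ) + 1) := by
    rw [Finset.prod_const, Finset.card_univ]
  have hT : (0 : ℝ) ≤ T.card := Nat.cast_nonneg _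
  refine (mul_le_mul_of_nonneg_right h2 (pow_nonneg hm _)).trans ?_
  rw [h3, h4, h5, ← Finset.prod_mul_distrib, ← Finset.prod_mul_distrib]
  refine Finset.prod_le_prod (fun x _ => ?_) fun x _ => ?_
  · split_ifs <;> positivity
  · by_cases hxA : x ∈ A
    · simp [hxA]
    · by_cases hxZ : x ∈ Z
      · simp [hxA, hxZ]
      · simp only [hxA, hxZ, Finset.mem_sdiff, Finset.mem_compl, if_false, not_false_eq_true,
          if_true, and_true]
        nlinarith

lemma sum_wt_union_le {r : Fin p → ℝ} (hr : ∀ i, 0 < r i ∧ r i ≤ 1)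
    (H : Fin p × Finset U → Bool) (f : U → V) (A : Finset U) (W : U → Finset V) {m : ℝ}
    (hm : 0 ≤ m) (hW : ∀ x, ((W x).card : ℝ) ≤ m)
    (hZ : ∀ Z, A ⊆ Z → 1 ≤ m ^ (Z \ A).card * wt r (relEdg H A Z))
    {S : Finset (Fin p × Finset V)} {T : Finset V} (hS : ∀ e ∈ S, e.2 ⊆ T) :
    ∑ g ∈ copies f A W, wt r (S ∪ (relEdg H A Finset.univ).image (push g)) ≤
      2 ^ Fintype.card U * ((T.card : ℝ) + 1) ^ Fintype.card U *
        (wt r S * (m ^ Aᶜ.card * wt r (relEdg H A Finset.univ))) := by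
  rw [← Finset.sum_fiberwise (copies f A W)
    (fun g => A ∪ (Finset.univ.filter fun x => g x ∈ T))]
  have hc : (2 : ℝ) ^ Fintype.card U = ∑ _Z : Finset U, (1 : ℝ) := by simp
  rw [hc, mul_assoc, Finset.sum_mul]
  refine Finset.sum_le_sum fun Z _ => ?_
  have hS0 := (wt_pos hr S).le
  have hD0 := (wt_pos hr (relEdg H A Finset.univ)).le
  have hb : ∀ g ∈ (copies f A W).filter fun g =>
      A ∪ (Finset.univ.filter fun x => g x ∈ T) = Z,
      wt r (S ∪ (relEdg H A Finset.univ).image (push g)) ≤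
        m ^ (Z \ A).card * (wt r S * wt r (relEdg H A Finset.univ)) := by
    intro g hg
    simp only [copies, Finset.mem_filter, Finset.mem_univ, true_and] at hg
    obtain ⟨⟨hinj, -, -⟩, rfl⟩ := hg
    have h1 := wt_union_image_le hr H A hinj hS
      (Z := A ∪ Finset.univ.filter fun x => g x ∈ T) (fun x hx => by simp [hx])
    have h2 := hZ (A ∪ Finset.univ.filter fun x => g x ∈ T) Finset.subset_union_left
    have h3 := wt_pos hr (S ∪ (relEdg H A Finset.univ).image (push g))
    calc wt r (S ∪ (relEdg H A Finset.univ).image (push g))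
        ≤ wt r (S ∪ (relEdg H A Finset.univ).image (push g)) *
          (m ^ ((A ∪ Finset.univ.filter fun x => g x ∈ T) \ A).card *
            wt r (relEdg H A (A ∪ Finset.univ.filter fun x => g x ∈ T))) :=
          le_mul_of_one_le_right h3.le h2
      _ = m ^ ((A ∪ Finset.univ.filter fun x => g x ∈ T) \ A).card *
          (wt r (S ∪ (relEdg H A Finset.univ).image (push g)) *
            wt r (relEdg H A (A ∪ Finset.univ.filter fun x => g x ∈ T))) := by ring
      _ ≤ _ := mul_le_mul_of_nonneg_left h1 (pow_nonneg hm _)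
  refine (Finset.sum_le_sum hb).trans ?_
  rw [Finset.sum_const, nsmul_eq_mul, ← mul_assoc, one_mul]
  refine (mul_le_mul_of_nonneg_right (card_copies_fiber_mul_le f A W hm hW T)
    (mul_nonneg hS0 hD0)).trans (le_of_eq (by ring))

/-- Moments of the number of copies of a safe extension. -/
lemma ex_numPos_pow_le (H : Fin p × Finset U → Bool) (A : Finset U) (k τ : ℕ) :
    ∃ K : ℝ, 0 < K ∧ ∀ (V : Type) [Fintype V] (r : Fin p → ℝ) (q : Fin p × Finset V → ℝ)
      (f : U → V) (W : U → Finset V) (m : ℝ), (∀ i, 0 < r i ∧ r i ≤ 1) →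
      (∀ e, 0 ≤ q e ∧ q e ≤ r e.1) → 0 ≤ m → (∀ x, ((W x).card : ℝ) ≤ m) →
      (∀ Z, A ⊆ Z → 1 ≤ m ^ (Z \ A).card * wt r (relEdg H A Z)) →
      ∀ (S : Finset (Fin p × Finset V)) (T : Finset V), (∀ e ∈ S, e.2 ⊆ T) → T.card ≤ τ →
        ex q (fun ω => (if ∀ e ∈ S, ω e = true then 1 else 0) * numPos H f A W ω ^ k) ≤
          K * (wt r S * (m ^ Aᶜ.card * wt r (relEdg H A Finset.univ)) ^ k) := by
  induction k generalizing τ with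
  | zero =>
    refine ⟨1, one_pos, fun V _ r q f W m hr hq hm hW hZ S T hS hT => ?_⟩
    have h := pr_cylinder q S (fun _ => true)
    simp only [if_true] at h
    simp only [pow_zero, mul_one, one_mul]
    refine (le_of_eq (Eq.trans ?_ h)).trans
      (Finset.prod_le_prod (fun e _ => (hq e).1) fun e _ => (hq e).2)
    simp only [pr]
    congr! 3
  | succ k ih =>
    obtain ⟨K, hK, hb⟩ := ih (τ + Fintype.card U)
    refine ⟨K * (2 ^ Fintype.card U * ((τ : ℝ) + 1) ^ Fintype.card U), by positivity,
      fun V _ r q f W m hr hq hm hW hZ S T hS hT => ?_⟩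
    have h1 : (fun ω => (if ∀ e ∈ S, ω e = true then (1 : ℝ) else 0) *
        numPos H f A W ω ^ (k + 1)) = fun ω => ∑ g ∈ copies f A W,
          (if ∀ e ∈ S ∪ (relEdg H A Finset.univ).image (push g), ω e = true then (1 : ℝ) else 0) *
            numPos H f A W ω ^ k := by
      funext ω
      rw [pow_succ', ← mul_assoc]
      conv_lhs => rw [numPos]
      rw [Finset.mul_sum, Finset.sum_mul]
      refine Finset.sum_congr rfl fun g _ => ?_
      congr 1
      have h2 : (∀ e ∈ S ∪ (relEdg H A Finset.univ).image (push g), ω e = true) ↔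
          (∀ e ∈ S, ω e = true) ∧
            ∀ e ∈ (relEdg H A Finset.univ).image (push g), ω e = true := by
        simp only [Finset.mem_union, or_imp, forall_and]
      by_cases h3 : ∀ e ∈ S, ω e = true
      · by_cases h4 : ∀ e ∈ (relEdg H A Finset.univ).image (push g), ω e = true
        · rw [if_pos h3, if_pos h4, if_pos (h2.2 ⟨h3, h4⟩), one_mul]
        · rw [if_neg h4, if_neg fun h => h4 (h2.1 h).2, mul_zero]
      · rw [if_neg h3, if_neg fun h => h3 (h2.1 h).1, zero_mul]
    rw [h1, ex_sum]
    set μ := m ^ Aᶜ.card * wt r (relEdg H A Finset.univ) with hμ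
    have hμ0 : 0 ≤ μ := mul_nonneg (pow_nonneg hm _) (wt_pos hr _).le
    calc _ ≤ ∑ g ∈ copies f A W,
          K * (wt r (S ∪ (relEdg H A Finset.univ).image (push g)) * μ ^ k) := by
          refine Finset.sum_le_sum fun g _ => hb V r q f W m hr hq hm hW hZ _
            (T ∪ Finset.univ.image g) (fun e he => ?_) ?_
          · rcases Finset.mem_union.1 he with he | he
            · exact (hS e he).trans Finset.subset_union_left
            · obtain ⟨e', -, rfl⟩ := Finset.mem_image.1 he
              exact (Finset.image_subset_image (Finset.subset_univ _)).trans
                Finset.subset_union_right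
          · refine (Finset.card_union_le _ _).trans (add_le_add hT ?_)
            exact Finset.card_image_le.trans (Finset.card_univ).le
      _ = K * μ ^ k * ∑ g ∈ copies f A W,
          wt r (S ∪ (relEdg H A Finset.univ).image (push g)) := by
          rw [Finset.mul_sum]
          exact Finset.sum_congr rfl fun _ _ => by ring
      _ ≤ K * μ ^ k * (2 ^ Fintype.card U * ((T.card : ℝ) + 1) ^ Fintype.card U *
          (wt r S * μ)) :=
          mul_le_mul_of_nonneg_left (sum_wt_union_le hr H f A W hm hW hZ hS) (by positivity)
      _ ≤ K * μ ^ k * (2 ^ Fintype.card U * ((τ : ℝ) + 1) ^ Fintype.card U *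
          (wt r S * μ)) := by
          have hTτ : (T.card : ℝ) ≤ τ := Nat.cast_le.2 hT
          have := (wt_pos hr S).le
          gcongr
      _ = _ := by ring

end Moments

section LowerTail

variable {U V : Type} [Fintype U] [Fintype V]

/-- The potential relations that involve a vertex outside `A`. -/
noncomputable def coords (A : Finset U) : Finset (Fin p × Finset U) :=
  Finset.univ.filter fun e => ¬ e.2 ⊆ A

/-- The number of members of `copies f A W` that induce `H` over `A`. -/
noncomputable def numInd (H : Fin p × Finset U → Bool) (f : U → V) (A : Finset U)
    (W : U → Finset V) (ω : Fin p × Finset V → Bool) : ℝ :=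
  ∑ g ∈ copies f A W, if ∀ e ∈ coords A, ω (push g e) = H e then 1 else 0

lemma numInd_nonneg (H : Fin p × Finset U → Bool) (f : U → V) (A : Finset U)
    (W : U → Finset V) (ω : Fin p × Finset V → Bool) : 0 ≤ numInd H f A W ω :=
  Finset.sum_nonneg fun g _ => by split_ifs <;> norm_num

lemma numInd_le_numPos (H : Fin p × Finset U → Bool) (f : U → V) (A : Finset U)
    (W : U → Finset V) (ω : Fin p × Finset V → Bool) :
    numInd H f A W ω ≤ numPos H f A W ω := by
  refine Finset.sum_le_sum fun g _ => ?_
  split_ifs with h1 h2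
  · exact le_rfl
  · refine absurd (fun e he => ?_) h2
    obtain ⟨e', he', rfl⟩ := Finset.mem_image.1 he
    rw [mem_relEdg] at he'
    rw [h1 e' (by simp [coords, he'.2.2]), he'.1]
  · norm_num
  · exact le_rfl

lemma numInd_mono (H : Fin p × Finset U → Bool) (f : U → V) (A : Finset U)
    {W W' : U → Finset V} (h : ∀ x, W x ⊆ W' x) (ω : Fin p × Finset V → Bool) :
    numInd H f A W ω ≤ numInd H f A W' ω := by
  refine Finset.sum_le_sum_of_subset_of_nonneg (fun g hg => ?_)
    fun g _ _ => by split_ifs <;> norm_num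
  simp only [copies, Finset.mem_filter, Finset.mem_univ, true_and] at hg ⊢
  exact ⟨hg.1, hg.2.1, fun x hx => h x (hg.2.2 x hx)⟩

/-- The expected number of induced copies, when the targets of the vertices are disjoint. -/
lemma le_ex_numInd {k : Fin p → ℕ} (H : Fin p × Finset U → Bool)
    (hH : ∀ e, H e = true → e.2.card = k e.1) (A : Finset U) {r : Fin p → ℝ}
    {q : Fin p × Finset V → ℝ} {f : U → V} {W : U → Finset V} {m : ℕ}
    (hr : ∀ i, 0 < r i ∧ r i ≤ 1 / 2)
    (hq : ∀ e, q e = if e.2.card = k e.1 then r e.1 else 0) (hf : Set.InjOn f A)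
    (hWm : ∀ x, (W x).card = m) (hWd : ∀ x y, x ≠ y → Disjoint (W x) (W y))
    (hWf : ∀ x, ∀ y ∈ A, f y ∉ W x) :
    (1 / 2) ^ Fintype.card (Fin p × Finset U) *
      ((m : ℝ) ^ Aᶜ.card * wt r (relEdg H A Finset.univ)) ≤ ex q (numInd H f A W) := by
  have hcop : copies f A W = Fintype.piFinset fun x => if x ∈ A then {f x} else W x := by
    ext g
    simp only [copies, Finset.mem_filter, Finset.mem_univ, true_and, Fintype.mem_piFinset]
    constructor
    · rintro ⟨-, h1, h2⟩ x
      by_cases hx : x ∈ A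
      · simp [hx, h1 x hx]
      · simp [hx, h2 x hx]
    · intro h
      have h1 : ∀ x ∈ A, g x = f x := fun x hx => by simpa [hx] using h x
      have h2 : ∀ x, x ∉ A → g x ∈ W x := fun x hx => by simpa [hx] using h x
      refine ⟨fun x y hxy => ?_, h1, h2⟩
      by_cases hx : x ∈ A <;> by_cases hy : y ∈ A
      · exact hf hx hy (by rw [← h1 x hx, ← h1 y hy, hxy])
      · exact absurd (h2 y hy) (by rw [← hxy, h1 x hx]; exact hWf y x hx)
      · exact absurd (h2 x hx) (by rw [hxy, h1 y hy]; exact hWf x y hy)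
      · by_contra hne
        exact Finset.disjoint_left.1 (hWd x y hne) (h2 x hx) (hxy ▸ h2 y hy)
  have hcard : ((copies f A W).card : ℝ) = (m : ℝ) ^ Aᶜ.card := by
    have h4 : (m : ℝ) ^ Aᶜ.card = ∏ x, if x ∈ Aᶜ then (m : ℝ) else 1 := by
      rw [Finset.prod_ite_mem, Finset.univ_inter, Finset.prod_const]
    rw [hcop, Fintype.card_piFinset, Nat.cast_prod, h4]
    refine Finset.prod_congr rfl fun x _ => ?_
    by_cases hx : x ∈ A <;> simp [hx, hWm]
  have hpr : ∀ g ∈ copies f A W, (1 / 2) ^ Fintype.card (Fin p × Finset U) *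
      wt r (relEdg H A Finset.univ) ≤
      ex q (fun ω => if ∀ e ∈ coords A, ω (push g e) = H e then 1 else 0) := by
    intro g hg
    simp only [copies, Finset.mem_filter, Finset.mem_univ, true_and] at hg
    have hpi := push_injective (p := p) hg.1
    let x : Fin p × Finset V → Bool := fun e => decide (∃ e', push g e' = e ∧ H e' = true)
    have hx : ∀ e, x (push g e) = H e := fun e => by
      cases he : H e
      · simp only [x, decide_eq_false_iff_not]
        rintro ⟨e', h1, h2⟩
        rw [hpi h1, he] at h2
        exact absurd h2 (by simp)
      · exact decide_eq_true ⟨e, rfl, he⟩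
    have h1 := pr_cylinder q ((coords A).image (push g)) x
    rw [Finset.prod_image hpi.injOn] at h1
    have h2 : ex q (fun ω => if ∀ e ∈ coords A, ω (push g e) = H e then 1 else 0) =
        ∏ e ∈ coords A, if x (push g e) = true then q (push g e) else 1 - q (push g e) := by
      rw [← h1, pr]
      congr 1
      funext ω
      have : (∀ e ∈ coords A, ω (push g e) = H e) ↔
          ∀ e ∈ (coords A).image (push g), ω e = x e := by
        rw [Finset.forall_mem_image]
        exact forall₂_congr fun e _ => by rw [hx]
      simp only [this]
      congr!
    rw [h2]
    have h3 : wt r (relEdg H A Finset.univ) =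
        ∏ e ∈ coords A, if H e = true then r e.1 else 1 := by
      rw [← Finset.prod_filter, wt]
      refine Finset.prod_congr ?_ fun _ _ => rfl
      ext e
      simp [mem_relEdg, coords, and_comm]
    have h4 : ((1 : ℝ) / 2) ^ Fintype.card (Fin p × Finset U) ≤ ∏ e ∈ coords (p := p) A, 1 / 2 := by
      rw [Finset.prod_const]
      exact pow_le_pow_of_le_one (by norm_num) (by norm_num) (Finset.card_le_univ _)
    rw [h3]
    refine (mul_le_mul_of_nonneg_right h4 (Finset.prod_nonneg fun e _ => ?_)).trans ?_
    · split_ifs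
      · exact (hr _).1.le
      · norm_num
    rw [← Finset.prod_mul_distrib]
    refine Finset.prod_le_prod (fun e _ => ?_) fun e _ => ?_
    · split_ifs
      · have := (hr e.1).1
        positivity
      · norm_num
    · rw [hx, hq]
      have hc : (push g e).2.card = e.2.card := Finset.card_image_of_injective _ hg.1
      have he1 : (push g e).1 = e.1 := rfl
      rw [hc, he1]
      have := hr e.1
      by_cases he : H e = true
      · simp only [he, hH e he, if_true]
        linarith
      · rw [if_neg he, if_neg he, mul_one]
        split_ifs <;> linarith [this.2]
  have h5 : ex q (numInd H f A W) = ∑ g ∈ copies f A W,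
      ex q (fun ω => if ∀ e ∈ coords A, ω (push g e) = H e then 1 else 0) := by
    rw [← ex_sum]
    rfl
  rw [h5]
  refine le_trans (le_of_eq ?_) (Finset.sum_le_sum hpr)
  rw [Finset.sum_const, nsmul_eq_mul, hcard]
  ring

lemma numInd_congr (H : Fin p × Finset U → Bool) {f : U → V} {A : Finset U}
    {W : U → Finset V} {ω ω' : Fin p × Finset V → Bool}
    (h : ∀ e : Fin p × Finset V, (∀ v ∈ e.2, v ∉ A.image f → ∃ x, v ∈ W x) →
      (∃ v ∈ e.2, ∃ x, v ∈ W x) → ω e = ω' e) :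
    numInd H f A W ω = numInd H f A W ω' := by
  refine Finset.sum_congr rfl fun g hg => ?_
  simp only [copies, Finset.mem_filter, Finset.mem_univ, true_and] at hg
  have : ∀ e ∈ coords (p := p) A, ω (push g e) = ω' (push g e) := fun e he => by
    simp only [coords, Finset.mem_filter, Finset.mem_univ, true_and] at he
    refine h _ (fun v hv hvA => ?_) ?_
    · obtain ⟨x, -, rfl⟩ := Finset.mem_image.1 hv
      refine ⟨x, hg.2.2 x fun hx => hvA ?_⟩
      rw [hg.2.1 x hx]
      exact Finset.mem_image_of_mem f hx
    · obtain ⟨x, hx, hxA⟩ := Finset.not_subset.1 he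
      exact ⟨g x, Finset.mem_image_of_mem g hx, x, hg.2.2 x hxA⟩
  have h2 : (∀ e ∈ coords A, ω (push g e) = H e) ↔ ∀ e ∈ coords A, ω' (push g e) = H e :=
    forall₂_congr fun e he => by rw [this e he]
  simp only [h2]

/-- Disjoint target sets of prescribed size that avoid the image of `A`. -/
lemma exists_blocks (f : U → V) (A : Finset U) {L m : ℕ}
    (h : L * (Fintype.card U * m) + Fintype.card U ≤ Fintype.card V) :
    ∃ W : ℕ → U → Finset V, (∀ l < L, ∀ x, (W l x).card = m) ∧
      (∀ l x l' x', (l, x) ≠ (l', x') → Disjoint (W l x) (W l' x')) ∧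
      ∀ l x, ∀ y ∈ A, f y ∉ W l x := by
  have h1 : Fintype.card (Fin L × U × Fin m) ≤ Fintype.card {v // v ∉ A.image f} := by
    rw [Fintype.card_subtype_compl, Fintype.card_coe]
    simp only [Fintype.card_prod, Fintype.card_fin]
    have := (Finset.card_image_le (s := A) (f := f)).trans (Finset.card_le_univ A)
    omega
  obtain ⟨φ⟩ := Function.Embedding.nonempty_of_card_le h1
  refine ⟨fun l x => if hl : l < L then
    Finset.univ.image fun j : Fin m => (φ (⟨l, hl⟩, x, j)).1 else ∅, ?_, ?_, ?_⟩
  · intro l hl x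
    simp only [hl, dif_pos]
    rw [Finset.card_image_of_injective, Finset.card_univ, Fintype.card_fin]
    intro j j' hj
    simpa using φ.injective (Subtype.ext hj)
  · intro l x l' x' hne
    by_cases hl : l < L <;> by_cases hl' : l' < L <;> simp only [hl, hl', dif_pos, dif_neg,
      not_false_eq_true, Finset.disjoint_empty_left, Finset.disjoint_empty_right]
    rw [Finset.disjoint_left]
    intro v hv hv'
    obtain ⟨j, -, rfl⟩ := Finset.mem_image.1 hv
    obtain ⟨j', -, hj⟩ := Finset.mem_image.1 hv'
    have := φ.injective (Subtype.ext hj)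
    simp only [Prod.mk.injEq, Fin.mk.injEq] at this
    exact hne (by rw [this.1, this.2.1])
  · intro l x y hy
    by_cases hl : l < L
    · simp only [hl, dif_pos]
      intro h2
      obtain ⟨j, -, hj⟩ := Finset.mem_image.1 h2
      exact (φ (⟨l, hl⟩, x, j)).2 (hj ▸ Finset.mem_image_of_mem f hy)
    · simp [hl]

/-- Few induced copies of a safe extension is an exponentially unlikely event. -/
lemma exists_pr_numInd_lt_le {k : Fin p → ℕ} (H : Fin p × Finset U → Bool)
    (hH : ∀ e, H e = true → e.2.card = k e.1) (A : Finset U) :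
    ∃ c : ℝ, 0 < c ∧ ∃ ρ : ℝ, 0 ≤ ρ ∧ ρ < 1 ∧ ∀ (V : Type) [Fintype V] (r : Fin p → ℝ)
      (q : Fin p × Finset V → ℝ) (f : U → V) (m L : ℕ), (∀ i, 0 < r i ∧ r i ≤ 1 / 2) →
      (∀ e, q e = if e.2.card = k e.1 then r e.1 else 0) → Set.InjOn f A →
      (∀ Z, A ⊆ Z → 1 ≤ (m : ℝ) ^ (Z \ A).card * wt r (relEdg H A Z)) →
      L * (Fintype.card U * m) + Fintype.card U ≤ Fintype.card V →
      pr q (fun ω => numInd H f A (fun _ => Finset.univ) ω <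
        c * ((m : ℝ) ^ Aᶜ.card * wt r (relEdg H A Finset.univ))) ≤ ρ ^ L := by
  obtain ⟨K, hK, hmom⟩ := ex_numPos_pow_le H A 2 0
  let c : ℝ := (1 / 2) ^ Fintype.card (Fin p × Finset U) / 2
  have hc : 0 < c := by positivity
  refine ⟨c, hc, max 0 (1 - c ^ 2 / K), le_max_left _ _,
    max_lt one_pos (by linarith [show 0 < c ^ 2 / K by positivity]), ?_⟩
  intro V _ r q f m L hr hq hf hZ hcard
  have hr1 : ∀ i, 0 < r i ∧ r i ≤ 1 := fun i => ⟨(hr i).1, (hr i).2.trans (by norm_num)⟩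
  have hqr : ∀ e, 0 ≤ q e ∧ q e ≤ r e.1 := fun e => by
    rw [hq]
    have := (hr e.1).1
    split_ifs
    · exact ⟨this.le, le_rfl⟩
    · exact ⟨le_rfl, this.le⟩
  have hq01 : ∀ e, 0 ≤ q e ∧ q e ≤ 1 := fun e => ⟨(hqr e).1, (hqr e).2.trans (hr1 e.1).2⟩
  set μ := (m : ℝ) ^ Aᶜ.card * wt r (relEdg H A Finset.univ) with hμ
  have hμ0 : 0 < μ := by
    have := hZ Finset.univ (Finset.subset_univ _)
    rw [← Finset.compl_eq_univ_sdiff] at this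
    linarith
  obtain ⟨W, hWm, hWd, hWf⟩ := exists_blocks f A hcard
  have hblock : ∀ l < L, pr q (fun ω => numInd H f A (W l) ω < c * μ) ≤
      max 0 (1 - c ^ 2 / K) := by
    intro l hl
    have h1 := le_ex_numInd H hH A hr hq hf (hWm l hl)
      (fun x y hxy => hWd l x l y (by simpa using hxy)) (hWf l)
    have h2 := sq_le_ex_sq_mul_pr hq01 (f := numInd H f A (W l)) (c := c * μ)
      (by positivity) (by
        refine le_trans (le_of_eq ?_) h1
        simp only [c]
        ring)
    have h3 : ex q (fun ω => numInd H f A (W l) ω ^ 2) ≤ K * μ ^ 2 := by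
      have h4 := hmom V r q f (W l) m hr1 hqr (Nat.cast_nonneg _)
        (fun x => by rw [hWm l hl x]) hZ ∅ ∅ (by simp) (by simp)
      refine le_trans (ex_mono hq01 fun ω => ?_) (h4.trans (le_of_eq ?_))
      · simp only [Finset.notMem_empty, false_imp_iff, implies_true, if_true, one_mul]
        exact pow_le_pow_left₀ (numInd_nonneg H f A (W l) ω) (numInd_le_numPos H f A (W l) ω) 2
      · simp [wt, hμ]
    have h5 : pr q (fun ω => numInd H f A (W l) ω < c * μ) =
        1 - pr q (fun ω => c * μ ≤ numInd H f A (W l) ω) := by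
      rw [← pr_not]
      simp only [not_le]
    rw [h5]
    refine le_max_of_le_right (sub_le_sub_left ?_ 1)
    have h6 := h2.trans (mul_le_mul_of_nonneg_right h3 (pr_nonneg hq01 _))
    rw [div_le_iff₀ hK]
    have h7 : c ^ 2 * μ ^ 2 ≤
        (pr q (fun ω => c * μ ≤ numInd H f A (W l) ω) * K) * μ ^ 2 := by
      linarith
    exact le_of_mul_le_mul_right h7 (by positivity)
  refine le_trans (pr_mono hq01 fun ω hω l _ =>
    (numInd_mono H f A (fun x => Finset.subset_univ (W l x)) ω).trans_lt hω)
    (pr_forall_le_pow hq01 L (fun l => {e : Fin p × Finset V |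
      (∀ v ∈ e.2, v ∉ A.image f → ∃ x, v ∈ W l x) ∧ ∃ v ∈ e.2, ∃ x, v ∈ W l x})
      (fun l l' hne => ?_) (fun l ω => numInd H f A (W l) ω < c * μ) (fun l ω ω' h => ?_) hblock)
  · rw [Set.disjoint_left]
    rintro e ⟨-, v, hv, x, hx⟩ ⟨h1, -⟩
    obtain ⟨x', hx'⟩ := h1 v hv fun hvA => by
      obtain ⟨y, hy, rfl⟩ := Finset.mem_image.1 hvA
      exact hWf l x y hy hx
    exact Finset.disjoint_left.1 (hWd l x l' x' (by simp [hne])) hx hx'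
  · simp only [numInd_congr H fun e h1 h2 => h e ⟨h1, h2⟩]

end LowerTail

section AlmostSure

/-- The probability of a relation of the `i`-th kind in a random structure with `n` elements. -/
noncomputable def rateAt (α γ : Fin p → ℝ) (n : ℕ) (i : Fin p) : ℝ :=
  γ i * (n : ℝ) ^ (-(α i))

/-- The probability of each potential relation in the random structure on `V`. -/
noncomputable def edgeProb (k : Fin p → ℕ) (α γ : Fin p → ℝ) (V : Type) [Fintype V]
    (e : Fin p × Finset V) : ℝ :=
  if e.2.card = k e.1 then rateAt α γ (Fintype.card V) e.1 else 0

/-- The event `Q` has probability tending to `1` in the random structure on `V` as the size of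
`V` tends to infinity. -/
def AlmostSurely (k : Fin p → ℕ) (α γ : Fin p → ℝ)
    (Q : ∀ (V : Type) [Fintype V], (Fin p × Finset V → Bool) → Prop) : Prop :=
  ∀ ε : ℝ, 0 < ε → ∃ N : ℕ, ∀ (V : Type) [Fintype V], N ≤ Fintype.card V →
    pr (edgeProb k α γ V) (fun ω => ¬ Q V ω) ≤ ε

variable {k : Fin p → ℕ} {α γ : Fin p → ℝ}

lemma rateAt_nonneg (hγ : ∀ i, 0 < γ i ∧ γ i ≤ 1) (n : ℕ) (i : Fin p) : 0 ≤ rateAt α γ n i :=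
  mul_nonneg (hγ i).1.le (Real.rpow_nonneg (Nat.cast_nonneg _) _)

lemma rateAt_le_one (hα : ∀ i, 0 < α i) (hγ : ∀ i, 0 < γ i ∧ γ i ≤ 1) (n : ℕ) (i : Fin p) :
    rateAt α γ n i ≤ 1 := by
  rcases n.eq_zero_or_pos with rfl | hn
  · simp [rateAt, Real.zero_rpow (neg_ne_zero.2 (hα i).ne')]
  · exact mul_le_one₀ (hγ i).2 (Real.rpow_nonneg (Nat.cast_nonneg _) _)
      (Real.rpow_le_one_of_one_le_of_nonpos (by exact_mod_cast hn) (by linarith [hα i]))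

lemma rateAt_pos (hγ : ∀ i, 0 < γ i ∧ γ i ≤ 1) {n : ℕ} (hn : 0 < n) (i : Fin p) :
    0 < rateAt α γ n i :=
  mul_pos (hγ i).1 (Real.rpow_pos_of_pos (by exact_mod_cast hn) _)

lemma edgeProb_mem (hα : ∀ i, 0 < α i) (hγ : ∀ i, 0 < γ i ∧ γ i ≤ 1) (V : Type) [Fintype V]
    (e : Fin p × Finset V) : 0 ≤ edgeProb k α γ V e ∧ edgeProb k α γ V e ≤ 1 := by
  unfold edgeProb
  split_ifs
  · exact ⟨rateAt_nonneg hγ _ _, rateAt_le_one hα hγ _ _⟩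
  · norm_num

lemma edgeProb_le_rateAt (hγ : ∀ i, 0 < γ i ∧ γ i ≤ 1) (V : Type) [Fintype V]
    (e : Fin p × Finset V) : edgeProb k α γ V e ≤ rateAt α γ (Fintype.card V) e.1 := by
  unfold edgeProb
  split_ifs
  · exact le_rfl
  · exact rateAt_nonneg hγ _ _

lemma AlmostSurely.of_tendsto {Q : ∀ (V : Type) [Fintype V], (Fin p × Finset V → Bool) → Prop}
    {u : ℕ → ℝ} (hu : Tendsto u atTop (𝓝 0))
    (h : ∀ᶠ n : ℕ in atTop, ∀ (V : Type) [Fintype V], Fintype.card V = n →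
      pr (edgeProb k α γ V) (fun ω => ¬ Q V ω) ≤ u n) : AlmostSurely k α γ Q := by
  intro ε hε
  obtain ⟨N, hN⟩ := eventually_atTop.1 (h.and (hu.eventually (gt_mem_nhds hε)))
  exact ⟨N, fun V _ hV => ((hN _ hV).1 V rfl).trans (hN _ hV).2.le⟩

lemma AlmostSurely.mono (hα : ∀ i, 0 < α i) (hγ : ∀ i, 0 < γ i ∧ γ i ≤ 1)
    {Q R : ∀ (V : Type) [Fintype V], (Fin p × Finset V → Bool) → Prop}
    (hQ : AlmostSurely k α γ Q)
    (h : ∀ᶠ n : ℕ in atTop, ∀ (V : Type) [Fintype V], Fintype.card V = n →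
      ∀ ω, Q V ω → R V ω) : AlmostSurely k α γ R := by
  intro ε hε
  obtain ⟨N, hN⟩ := hQ ε hε
  obtain ⟨N', hN'⟩ := eventually_atTop.1 h
  refine ⟨max N N', fun V _ hV => ?_⟩
  exact (pr_mono (edgeProb_mem hα hγ V) fun ω hω hQω =>
    hω (hN' _ (le_of_max_le_right hV) V rfl ω hQω)).trans (hN V (le_of_max_le_left hV))

lemma AlmostSurely.and (hα : ∀ i, 0 < α i) (hγ : ∀ i, 0 < γ i ∧ γ i ≤ 1)
    {Q R : ∀ (V : Type) [Fintype V], (Fin p × Finset V → Bool) → Prop}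
    (hQ : AlmostSurely k α γ Q) (hR : AlmostSurely k α γ R) :
    AlmostSurely k α γ (fun V _ ω => Q V ω ∧ R V ω) := by
  intro ε hε
  obtain ⟨N, hN⟩ := hQ (ε / 2) (half_pos hε)
  obtain ⟨N', hN'⟩ := hR (ε / 2) (half_pos hε)
  refine ⟨max N N', fun V _ hV => ?_⟩
  have h1 := hN V (le_of_max_le_left hV)
  have h2 := hN' V (le_of_max_le_right hV)
  have h3 := pr_or_le (edgeProb_mem (k := k) hα hγ V) (fun ω => ¬ Q V ω) (fun ω => ¬ R V ω)
  refine (pr_mono (edgeProb_mem hα hγ V) fun ω hω => ?_).trans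
    (h3.trans ((add_le_add h1 h2).trans (add_halves ε).le))
  exact not_and_or.1 hω

lemma AlmostSurely.forall {κ : Type*} [Finite κ] (hα : ∀ i, 0 < α i)
    (hγ : ∀ i, 0 < γ i ∧ γ i ≤ 1)
    {Q : κ → ∀ (V : Type) [Fintype V], (Fin p × Finset V → Bool) → Prop}
    (hQ : ∀ x, AlmostSurely k α γ (Q x)) :
    AlmostSurely k α γ (fun V _ ω => ∀ x, Q x V ω) := by
  have := Fintype.ofFinite κ
  intro ε hε
  choose N hN using fun x => hQ x (ε / (Fintype.card κ + 1)) (by positivity)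
  refine ⟨Finset.univ.sup N, fun V _ hV => ?_⟩
  have h1 := pr_exists_le (edgeProb_mem (k := k) hα hγ V) (fun x ω => ¬ Q x V ω)
  refine (pr_mono (edgeProb_mem hα hγ V) fun ω hω => not_forall.1 hω).trans (h1.trans ?_)
  refine (Finset.sum_le_sum fun x _ => hN x V
    ((Finset.le_sup (Finset.mem_univ x)).trans hV)).trans ?_
  rw [Finset.sum_const, Finset.card_univ, nsmul_eq_mul, mul_div_assoc', div_le_iff₀ (by positivity)]
  nlinarith

/-- If the events at the maps `U → V` all have probability at most `u n`, with `n ^ |U| * u n`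
tending to zero, then almost surely none of them occurs. -/
lemma AlmostSurely.forall_map (hα : ∀ i, 0 < α i) (hγ : ∀ i, 0 < γ i ∧ γ i ≤ 1)
    (U : Type) [Fintype U]
    {Q : ∀ (V : Type) [Fintype V], (U → V) → (Fin p × Finset V → Bool) → Prop} {u : ℕ → ℝ}
    (hu : Tendsto (fun n : ℕ => (n : ℝ) ^ Fintype.card U * u n) atTop (𝓝 0))
    (h : ∀ᶠ n : ℕ in atTop, ∀ (V : Type) [Fintype V], Fintype.card V = n → ∀ f : U → V,
      pr (edgeProb k α γ V) (fun ω => ¬ Q V f ω) ≤ u n) :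
    AlmostSurely k α γ (fun V _ ω => ∀ f, Q V f ω) := by
  refine .of_tendsto hu (h.mono fun n hn V _ hV => ?_)
  have h1 := pr_exists_le (edgeProb_mem (k := k) hα hγ V) (fun f ω => ¬ Q V f ω)
  refine (pr_mono (edgeProb_mem hα hγ V) fun ω hω => not_forall.1 hω).trans (h1.trans ?_)
  refine (Finset.sum_le_sum fun f _ => hn V hV f).trans ?_
  rw [Finset.sum_const, Finset.card_univ, nsmul_eq_mul, Fintype.card_fun, hV]
  push_cast
  exact le_rfl

lemma eventually_mul_rpow_le {a b : ℝ} (hab : a < b) (C : ℝ) :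
    ∀ᶠ n : ℕ in atTop, C * (n : ℝ) ^ a ≤ (n : ℝ) ^ b := by
  have h := (tendsto_rpow_atTop (sub_pos.2 hab)).comp tendsto_natCast_atTop_atTop
  filter_upwards [h.eventually_ge_atTop C, eventually_gt_atTop 0] with n hn hn0
  have hn0' : (0 : ℝ) < n := by exact_mod_cast hn0
  calc C * (n : ℝ) ^ a ≤ (n : ℝ) ^ (b - a) * (n : ℝ) ^ a :=
        mul_le_mul_of_nonneg_right hn (Real.rpow_nonneg hn0'.le _)
    _ = (n : ℝ) ^ b := by rw [← Real.rpow_add hn0', sub_add_cancel]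

lemma tendsto_mul_rpow_zero {a : ℝ} (ha : a < 0) (C : ℝ) :
    Tendsto (fun n : ℕ => C * (n : ℝ) ^ a) atTop (𝓝 0) := by
  have h := (tendsto_rpow_neg_atTop (neg_pos.2 ha)).comp tendsto_natCast_atTop_atTop
  simpa using h.const_mul C

lemma eventually_rateAt_le (hα : ∀ i, 0 < α i) :
    ∀ᶠ n : ℕ in atTop, ∀ i, rateAt α γ n i ≤ 1 / 2 := by
  refine eventually_all.2 fun i => ?_
  exact (tendsto_mul_rpow_zero (neg_lt_zero.2 (hα i)) (γ i)).eventually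
    (ge_mem_nhds (by norm_num))

lemma wt_rateAt {V : Type*} {n : ℕ} (hn : 0 < n) (S : Finset (Fin p × Finset V)) :
    wt (rateAt α γ n) S = wt γ S * (n : ℝ) ^ (-∑ e ∈ S, α e.1) := by
  have hn' : (0 : ℝ) < n := by exact_mod_cast hn
  rw [← Finset.sum_neg_distrib, Real.rpow_sum_of_pos hn', wt, wt, ← Finset.prod_mul_distrib]
  rfl

lemma pow_mul_wt_rateAt {U : Type} [Fintype U] (H : Fin p × Finset U → Bool) {A Z : Finset U}
    (h : A ⊆ Z) {n : ℕ} (hn : 0 < n) :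
    (n : ℝ) ^ (Z \ A).card * wt (rateAt α γ n) (relEdg H A Z) =
      wt γ (relEdg H A Z) * (n : ℝ) ^ (dl α H Z - dl α H A) := by
  have hn' : (0 : ℝ) < n := by exact_mod_cast hn
  rw [wt_rateAt hn, dl_sub α H h, sub_eq_add_neg, Real.rpow_add hn', Real.rpow_natCast, relEdg]
  ring

lemma pr_forall_true_le (hα : ∀ i, 0 < α i) (hγ : ∀ i, 0 < γ i ∧ γ i ≤ 1) (V : Type) [Fintype V]
    (S : Finset (Fin p × Finset V)) :
    pr (edgeProb k α γ V) (fun ω => ∀ e ∈ S, ω e = true) ≤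
      wt (rateAt α γ (Fintype.card V)) S := by
  have h := pr_cylinder (edgeProb k α γ V) S (fun _ => true)
  simp only [if_true] at h
  refine (le_of_eq (Eq.trans ?_ h)).trans (Finset.prod_le_prod
    (fun e _ => (edgeProb_mem hα hγ V e).1) fun e _ => edgeProb_le_rateAt hγ V e)
  congr!

lemma almostSurely_valid (hα : ∀ i, 0 < α i) (hγ : ∀ i, 0 < γ i ∧ γ i ≤ 1) :
    AlmostSurely k α γ (fun _ _ ω => ∀ e, ω e = true → e.2.card = k e.1) := by
  intro ε hε
  refine ⟨0, fun V _ _ => ?_⟩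
  have h1 := pr_exists_le (edgeProb_mem (k := k) hα hγ V)
    (fun e ω => ω e = true ∧ e.2.card ≠ k e.1)
  refine (pr_mono (edgeProb_mem hα hγ V) fun ω hω => ?_).trans
    (h1.trans ((Finset.sum_nonpos fun e _ => ?_).trans hε.le))
  · push Not at hω
    exact hω
  · by_cases he : e.2.card = k e.1
    · simp [he, pr, ex_const]
    · have h := pr_cylinder (edgeProb k α γ V) {e} (fun _ => true)
      simp only [Finset.prod_singleton, if_true, edgeProb, he, if_false] at h
      refine (pr_mono (edgeProb_mem hα hγ V) fun ω hω => ?_).trans h.le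
      simpa using hω.1

end AlmostSure

section Counting

variable {k : Fin p → ℕ} {α γ : Fin p → ℝ}

lemma almostSurely_no_copy (hα : ∀ i, 0 < α i) (hγ : ∀ i, 0 < γ i ∧ γ i ≤ 1) {U : Type}
    [Fintype U] (H : Fin p × Finset U → Bool) (hH : dl α H Finset.univ < 0) :
    AlmostSurely k α γ (fun V _ ω => ∀ g : U → V, ¬ IsEmbed H ω g) := by
  refine .forall_map hα hγ U (u := fun n => wt (rateAt α γ n) (edg H Finset.univ)) ?_
    (.of_forall fun n V _ hV g => ?_)
  · refine (tendsto_mul_rpow_zero hH (wt γ (edg H Finset.univ))).congr' ?_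
    filter_upwards [eventually_gt_atTop 0] with n hn
    have hn' : (0 : ℝ) < n := by exact_mod_cast hn
    rw [wt_rateAt hn, dl, sub_eq_add_neg, Real.rpow_add hn', Real.rpow_natCast, Finset.card_univ]
    ring
  · subst hV
    by_cases hg : Function.Injective g
    · rw [← wt_image_push _ hg]
      refine (pr_mono (edgeProb_mem hα hγ V) fun ω hω => ?_).trans
        (pr_forall_true_le hα hγ V ((edg H Finset.univ).image (push g)))
      rw [Finset.forall_mem_image]
      intro e he
      rw [(not_not.1 hω).2, (mem_edg.1 he).1]
    · refine le_trans (le_of_eq ?_) (Finset.prod_nonneg fun e _ => rateAt_nonneg hγ _ _)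
      have : ∀ ω : Fin p × Finset V → Bool, ¬ ¬¬ IsEmbed H ω g := fun ω h => hg (not_not.1 h).1
      simp only [pr, this, if_false, ex_const]

/-- The hypergraph induced along the map `g`. -/
noncomputable def pull {U V : Type*} (g : U → V) (ω : Fin p × Finset V → Bool)
    (e : Fin p × Finset U) : Bool :=
  ω (push g e)

lemma isEmbed_pull {U V : Type*} {g : U → V} (hg : Function.Injective g)
    (ω : Fin p × Finset V → Bool) : IsEmbed (pull g ω) ω g :=
  ⟨hg, fun _ => rfl⟩

lemma exists_map_image_eq {V : Type*} (X : Finset V) :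
    ∃ g : Fin X.card → V, Function.Injective g ∧ Finset.univ.image g = X := by
  refine ⟨fun i => X.equivFin.symm i, Subtype.val_injective.comp X.equivFin.symm.injective, ?_⟩
  ext x
  simp only [Finset.mem_image, Finset.mem_univ, true_and]
  exact ⟨fun ⟨i, hi⟩ => hi ▸ (X.equivFin.symm i).2, fun hx => ⟨X.equivFin ⟨x, hx⟩, by simp⟩⟩

lemma almostSurely_dl_nonneg (hα : ∀ i, 0 < α i) (hγ : ∀ i, 0 < γ i ∧ γ i ≤ 1) (S : ℕ) :
    AlmostSurely k α γ (fun _ _ ω => ∀ X, X.card ≤ S → 0 ≤ dl α ω X) := by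
  have h : AlmostSurely k α γ (fun V _ ω => ∀ (b : Fin (S + 1))
      (H : {H : Fin p × Finset (Fin b) → Bool // dl α H Finset.univ < 0}) (g : Fin b → V),
        ¬ IsEmbed H.1 ω g) :=
    .forall hα hγ fun b => .forall hα hγ fun H => almostSurely_no_copy hα hγ H.1 H.2
  refine h.mono hα hγ (.of_forall fun n V _ _ ω hω X hX => ?_)
  by_contra! hneg
  obtain ⟨g, hg, hgX⟩ := exists_map_image_eq X
  refine hω ⟨X.card, Nat.lt_succ_of_le hX⟩ ⟨pull g ω, ?_⟩ g (isEmbed_pull hg ω)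
  rw [← dl_image α (isEmbed_pull hg ω), hgX]
  exact hneg

lemma almostSurely_numPos_le (hα : ∀ i, 0 < α i) (hγ : ∀ i, 0 < γ i ∧ γ i ≤ 1) {U : Type}
    [Fintype U] (H : Fin p × Finset U → Bool) {A : Finset U} (hA : Safe α H A) {η : ℝ}
    (hη : 0 < η) :
    AlmostSurely k α γ (fun V _ ω => ∀ f : U → V, numPos H f A (fun _ => Finset.univ) ω ≤
      (Fintype.card V : ℝ) ^ (dl α H Finset.univ - dl α H A + η)) := by
  set d := dl α H Finset.univ - dl α H A with hd
  obtain ⟨κ, hκ⟩ := exists_nat_gt ((Fintype.card U : ℝ) / η)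
  rw [div_lt_iff₀ hη] at hκ
  obtain ⟨K, hK, hmom⟩ := ex_numPos_pow_le H A κ 0
  refine .forall_map hα hγ U (u := fun n => K * (n : ℝ) ^ (-(κ * η))) ?_ ?_
  · refine (tendsto_mul_rpow_zero (sub_neg.2 hκ) K).congr' ?_
    filter_upwards [eventually_gt_atTop 0] with n hn
    have hn' : (0 : ℝ) < n := by exact_mod_cast hn
    rw [sub_eq_add_neg, Real.rpow_add hn', Real.rpow_natCast]
    ring
  have hZ : ∀ᶠ n : ℕ in atTop, ∀ Z : Finset U, A ⊆ Z →
      1 ≤ (n : ℝ) ^ (Z \ A).card * wt (rateAt α γ n) (relEdg H A Z) := by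
    refine eventually_all.2 fun Z => ?_
    by_cases hAZ : A ⊂ Z
    · filter_upwards [eventually_mul_rpow_le (sub_pos.2 (hA Z hAZ)) (wt γ (relEdg H A Z))⁻¹,
        eventually_gt_atTop 0] with n hn hn0 hAZ'
      rw [Real.rpow_zero, mul_one, inv_le_iff_one_le_mul₀ (wt_pos hγ _)] at hn
      rw [pow_mul_wt_rateAt H hAZ' hn0]
      linarith
    · refine .of_forall fun n hAZ' => ?_
      obtain rfl := (eq_or_ssubset_of_subset hAZ').resolve_right hAZ
      simp [relEdg, wt]
  filter_upwards [hZ, eventually_gt_atTop 0] with n hn hn0 V _ hV f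
  subst hV
  have hn' : (0 : ℝ) < Fintype.card V := by exact_mod_cast hn0
  have h1 := hmom V _ (edgeProb k α γ V) f (fun _ => Finset.univ) (Fintype.card V)
    (fun i => ⟨rateAt_pos hγ hn0 i, rateAt_le_one hα hγ _ i⟩)
    (fun e => ⟨(edgeProb_mem hα hγ V e).1, edgeProb_le_rateAt hγ V e⟩) hn'.le
    (fun _ => le_rfl) hn ∅ ∅ (by simp) (by simp)
  simp only [Finset.notMem_empty, false_imp_iff, implies_true, if_true, one_mul] at h1
  have h2 := mul_pr_le_ex (edgeProb_mem (k := k) hα hγ V)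
    (f := fun ω => numPos H f A (fun _ => Finset.univ) ω ^ κ)
    (fun ω => pow_nonneg (numPos_nonneg H f A _ ω) κ)
    (c := ((Fintype.card V : ℝ) ^ (d + η)) ^ κ)
  have h3 : (Fintype.card V : ℝ) ^ Aᶜ.card * wt (rateAt α γ (Fintype.card V))
      (relEdg H A Finset.univ) ≤ (Fintype.card V : ℝ) ^ d := by
    rw [Finset.compl_eq_univ_sdiff, pow_mul_wt_rateAt H (Finset.subset_univ _) hn0]
    exact mul_le_of_le_one_left (Real.rpow_nonneg hn'.le _) (wt_le_one hγ _)
  have hwe : wt (rateAt α γ (Fintype.card V)) (∅ : Finset (Fin p × Finset V)) = 1 := rfl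
  rw [hwe, one_mul] at h1
  have h5 := (h2.trans h1).trans (mul_le_mul_of_nonneg_left (pow_le_pow_left₀ (mul_nonneg
    (by positivity) (Finset.prod_nonneg fun e _ => rateAt_nonneg hγ _ _)) h3 κ) hK.le)
  refine (pr_mono (edgeProb_mem hα hγ V) fun ω hω =>
    pow_le_pow_left₀ (Real.rpow_nonneg hn'.le _) (not_le.1 hω).le κ).trans ?_
  set P := pr (edgeProb k α γ V) fun ω =>
    ((Fintype.card V : ℝ) ^ (d + η)) ^ κ ≤ numPos H f A (fun _ => Finset.univ) ω ^ κ
  rw [Real.rpow_add hn', mul_pow, mul_assoc, mul_comm K] at h5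
  have h10 := le_of_mul_le_mul_left h5 (by positivity)
  have h8 : (Fintype.card V : ℝ) ^ (-(κ * η)) * ((Fintype.card V : ℝ) ^ η) ^ κ = 1 := by
    rw [← Real.rpow_natCast ((Fintype.card V : ℝ) ^ η), ← Real.rpow_mul hn'.le,
      ← Real.rpow_add hn']
    simp [mul_comm]
  calc P = (Fintype.card V : ℝ) ^ (-(κ * η)) * (((Fintype.card V : ℝ) ^ η) ^ κ * P) := by
        rw [← mul_assoc, h8, one_mul]
    _ ≤ (Fintype.card V : ℝ) ^ (-(κ * η)) * K :=
        mul_le_mul_of_nonneg_left h10 (Real.rpow_nonneg hn'.le _)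
    _ = K * (Fintype.card V : ℝ) ^ (-(κ * η)) := mul_comm _ _

end Counting

section LowerBound

variable {k : Fin p → ℕ} {α γ : Fin p → ℝ}

lemma tendsto_pow_mul_pow_floor {a ρ : ℝ} (s : ℕ) (hρ : 0 ≤ ρ) (hρ1 : ρ < 1) (ha : 0 < a) :
    Tendsto (fun n : ℕ => (n : ℝ) ^ s * ρ ^ ⌊(n : ℝ) ^ a⌋₊) atTop (𝓝 0) := by
  obtain ⟨t, ht⟩ := exists_nat_ge ((s : ℝ) / a)
  have hL : Tendsto (fun n : ℕ => ⌊(n : ℝ) ^ a⌋₊) atTop atTop :=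
    tendsto_nat_floor_atTop.comp ((tendsto_rpow_atTop ha).comp tendsto_natCast_atTop_atTop)
  have h1 := ((tendsto_pow_const_mul_const_pow_of_lt_one t hρ hρ1).comp hL).const_mul (2 ^ t)
  rw [mul_zero] at h1
  refine squeeze_zero' (.of_forall fun n => by positivity) ?_ h1
  filter_upwards [hL.eventually_ge_atTop 1] with n hn
  rw [Function.comp_apply, ← mul_assoc, ← mul_pow]
  refine mul_le_mul_of_nonneg_right ?_ (pow_nonneg hρ _)
  have hn0 : (0 : ℝ) ≤ n := Nat.cast_nonneg n
  have hl : (1 : ℝ) ≤ ⌊(n : ℝ) ^ a⌋₊ := by exact_mod_cast hn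
  have h2 : (n : ℝ) ^ a ≤ 2 * ⌊(n : ℝ) ^ a⌋₊ := by linarith [Nat.lt_floor_add_one ((n : ℝ) ^ a)]
  calc (n : ℝ) ^ s = ((n : ℝ) ^ a) ^ ((s : ℝ) / a) := by
        rw [← Real.rpow_mul hn0, mul_div_cancel₀ _ ha.ne', Real.rpow_natCast]
    _ ≤ (2 * ⌊(n : ℝ) ^ a⌋₊) ^ ((s : ℝ) / a) :=
        Real.rpow_le_rpow (Real.rpow_nonneg hn0 _) h2 (by positivity)
    _ ≤ (2 * ⌊(n : ℝ) ^ a⌋₊) ^ (t : ℝ) :=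
        Real.rpow_le_rpow_of_exponent_le (by linarith) ht
    _ = _ := Real.rpow_natCast _ _

lemma le_floor_pow_mul_wt (hγ : ∀ i, 0 < γ i ∧ γ i ≤ 1) {U : Type}
    [Fintype U] (H : Fin p × Finset U → Bool) {A Z : Finset U} (h : A ⊆ Z) {n : ℕ} (hn : 0 < n)
    {η : ℝ} (hη : 0 < η) (hη1 : η < 1) :
    (1 / 2) ^ Fintype.card U * wt γ (relEdg H A Z) *
        (n : ℝ) ^ (dl α H Z - dl α H A - η * Fintype.card U) ≤
      (⌊(n : ℝ) ^ (1 - η)⌋₊ : ℝ) ^ (Z \ A).card * wt (rateAt α γ n) (relEdg H A Z) := by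
  have hn1 : (1 : ℝ) ≤ n := by exact_mod_cast hn
  have hn0 : (0 : ℝ) < n := by linarith
  have hc : (Z \ A).card ≤ Fintype.card U := Finset.card_le_univ _
  have hw := wt_pos hγ (relEdg H A Z)
  have h1 : (1 : ℝ) / 2 * (n : ℝ) ^ (1 - η) ≤ ⌊(n : ℝ) ^ (1 - η)⌋₊ := by
    have h2 : (1 : ℝ) ≤ (n : ℝ) ^ (1 - η) := Real.one_le_rpow hn1 (by linarith)
    have h3 : (1 : ℝ) ≤ ⌊(n : ℝ) ^ (1 - η)⌋₊ := by
      exact_mod_cast (Nat.one_le_floor_iff _).2 h2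
    linarith [Nat.lt_floor_add_one ((n : ℝ) ^ (1 - η))]
  refine le_trans ?_ (mul_le_mul_of_nonneg_right (pow_le_pow_left₀ (by positivity) h1 _)
    (Finset.prod_nonneg fun e _ => rateAt_nonneg hγ _ _))
  have h4 : ((n : ℝ) ^ (1 - η)) ^ (Z \ A).card =
      (n : ℝ) ^ (-(η * (Z \ A).card)) * (n : ℝ) ^ (Z \ A).card := by
    rw [← Real.rpow_natCast, ← Real.rpow_mul hn0.le, ← Real.rpow_natCast (n : ℝ),
      ← Real.rpow_add hn0]
    congr 1
    ring
  have h5 := pow_mul_wt_rateAt (α := α) (γ := γ) H h hn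
  rw [mul_pow, h4, mul_assoc, mul_assoc, mul_assoc, h5]
  refine mul_le_mul (pow_le_pow_of_le_one (by norm_num) (by norm_num) hc) ?_ (by positivity)
    (by positivity)
  rw [mul_left_comm, ← Real.rpow_add hn0]
  refine mul_le_mul_of_nonneg_left (Real.rpow_le_rpow_of_exponent_le hn1 ?_) hw.le
  have : η * (Z \ A).card ≤ η * Fintype.card U :=
    mul_le_mul_of_nonneg_left (Nat.cast_le.2 hc) hη.le
  linarith

lemma almostSurely_le_numInd (hα : ∀ i, 0 < α i) (hγ : ∀ i, 0 < γ i ∧ γ i ≤ 1) {U : Type}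
    [Fintype U] (H : Fin p × Finset U → Bool) (hH : ∀ e, H e = true → e.2.card = k e.1)
    {A : Finset U} (hA : Safe α H A) {η : ℝ} (hη : 0 < η) :
    AlmostSurely k α γ (fun V _ ω => ∀ f : U → V, Set.InjOn f A →
      (Fintype.card V : ℝ) ^ (dl α H Finset.univ - dl α H A - η) ≤
        numInd H f A (fun _ => Finset.univ) ω) := by
  obtain ⟨c, hc, ρ, hρ0, hρ1, hbound⟩ := exists_pr_numInd_lt_le H hH A
  have hsmall : ∀ x : ℝ, 0 < x → ∀ᶠ η' : ℝ in 𝓝[>] 0, η' * Fintype.card U < x := fun x hx => by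
    have : Tendsto (fun η' : ℝ => η' * Fintype.card U) (𝓝[>] 0) (𝓝 (0 * Fintype.card U)) :=
      (tendsto_id.mul_const _).mono_left nhdsWithin_le_nhds
    rw [zero_mul] at this
    exact this.eventually (gt_mem_nhds hx)
  obtain ⟨η', hη'1, hη'η, hη'Z, hη'0⟩ : ∃ η' : ℝ, η' < 1 ∧ η' * Fintype.card U < η ∧
      (∀ Z, A ⊂ Z → η' * Fintype.card U < dl α H Z - dl α H A) ∧ 0 < η' := by
    have h1 : ∀ᶠ η' : ℝ in 𝓝[>] 0, ∀ Z, A ⊂ Z → η' * Fintype.card U < dl α H Z - dl α H A := by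
      refine eventually_all.2 fun Z => ?_
      by_cases hZ : A ⊂ Z
      · exact (hsmall _ (sub_pos.2 (hA Z hZ))).mono fun _ h _ => h
      · exact .of_forall fun _ h => absurd h hZ
    exact (((gt_mem_nhds one_pos).filter_mono nhdsWithin_le_nhds).and ((hsmall η hη).and
      (h1.and self_mem_nhdsWithin))).exists
  refine .forall_map hα hγ U (tendsto_pow_mul_pow_floor (Fintype.card U) hρ0 hρ1
    (half_pos hη'0)) ?_
  have hZ : ∀ᶠ n : ℕ in atTop, ∀ Z : Finset U, A ⊆ Z →
      1 ≤ (⌊(n : ℝ) ^ (1 - η')⌋₊ : ℝ) ^ (Z \ A).card * wt (rateAt α γ n) (relEdg H A Z) := by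
    refine eventually_all.2 fun Z => ?_
    by_cases hAZ : A ⊂ Z
    · have hC : (0 : ℝ) < (1 / 2) ^ Fintype.card U * wt γ (relEdg H A Z) :=
        mul_pos (by positivity) (wt_pos hγ _)
      filter_upwards [eventually_mul_rpow_le (sub_pos.2 (hη'Z Z hAZ))
        ((1 / 2) ^ Fintype.card U * wt γ (relEdg H A Z))⁻¹, eventually_gt_atTop 0] with n hn hn0 hAZ'
      rw [Real.rpow_zero, mul_one, inv_le_iff_one_le_mul₀ hC, mul_comm] at hn
      exact hn.trans (le_floor_pow_mul_wt hγ H hAZ' hn0 hη'0 hη'1)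
    · refine .of_forall fun n hAZ' => ?_
      obtain rfl := (eq_or_ssubset_of_subset hAZ').resolve_right hAZ
      simp [relEdg, wt]
  have hC : (0 : ℝ) < c * ((1 / 2) ^ Fintype.card U * wt γ (relEdg H A Finset.univ)) :=
    mul_pos hc (mul_pos (by positivity) (wt_pos hγ _))
  filter_upwards [hZ, eventually_gt_atTop 0, eventually_rateAt_le (γ := γ) hα,
    eventually_mul_rpow_le (show 1 - η' / 2 < 1 by linarith) (2 * Fintype.card U),
    eventually_mul_rpow_le (show dl α H Finset.univ - dl α H A - η <
      dl α H Finset.univ - dl α H A - η' * Fintype.card U by linarith)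
      (c * ((1 / 2) ^ Fintype.card U * wt γ (relEdg H A Finset.univ)))⁻¹]
    with n hn hn0 hr hsize hlow V _ hV f
  subst hV
  have hn1 : (1 : ℝ) ≤ Fintype.card V := by exact_mod_cast hn0
  have hn' : (0 : ℝ) < Fintype.card V := by linarith
  by_cases hf : Set.InjOn f A
  swap
  · refine le_trans (le_of_eq ?_) (pow_nonneg hρ0 _)
    have : ∀ x y : ℝ, ¬¬(Set.InjOn f A → x ≤ y) := fun x y h => h fun h' => absurd h' hf
    simp only [pr, this, if_false, ex_const]
  have h1 := hbound V (rateAt α γ (Fintype.card V)) (edgeProb k α γ V) f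
    ⌊(Fintype.card V : ℝ) ^ (1 - η')⌋₊ ⌊(Fintype.card V : ℝ) ^ (η' / 2)⌋₊
    (fun i => ⟨rateAt_pos hγ hn0 i, hr i⟩) (fun e => rfl) hf hn ?_
  · refine (pr_mono (edgeProb_mem hα hγ V) fun ω hω => ?_).trans h1
    have h2 := le_floor_pow_mul_wt (α := α) hγ H (Finset.subset_univ A) hn0 hη'0 hη'1
    rw [← Finset.compl_eq_univ_sdiff] at h2
    refine lt_of_lt_of_le (not_le.1 fun h => hω fun _ => h) (le_trans ?_
      (mul_le_mul_of_nonneg_left h2 hc.le))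
    rwa [inv_mul_le_iff₀ hC, mul_assoc] at hlow
  · have hL := Nat.floor_le (Real.rpow_nonneg hn'.le (η' / 2))
    have hm := Nat.floor_le (Real.rpow_nonneg hn'.le (1 - η'))
    have h3 : (⌊(Fintype.card V : ℝ) ^ (η' / 2)⌋₊ : ℝ) * ⌊(Fintype.card V : ℝ) ^ (1 - η')⌋₊ ≤
        (Fintype.card V : ℝ) ^ (1 - η' / 2) := by
      refine (mul_le_mul hL hm (Nat.cast_nonneg _) (Real.rpow_nonneg hn'.le _)).trans
        (le_of_eq ?_)
      rw [← Real.rpow_add hn']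
      congr 1
      ring
    have h4 : (1 : ℝ) ≤ (Fintype.card V : ℝ) ^ (1 - η' / 2) :=
      Real.one_le_rpow hn1 (by linarith)
    rw [Real.rpow_one] at hsize
    have hU : (0 : ℝ) ≤ Fintype.card U := Nat.cast_nonneg _
    have h5 := mul_le_mul_of_nonneg_left h3 hU
    have h6 := mul_le_mul_of_nonneg_left h4 hU
    have h7 : (⌊(Fintype.card V : ℝ) ^ (η' / 2)⌋₊ : ℝ) *
        (Fintype.card U * ⌊(Fintype.card V : ℝ) ^ (1 - η')⌋₊) + Fintype.card U ≤
          Fintype.card V := by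
      linarith
    exact_mod_cast h7

end LowerBound

section Extension

variable {k : Fin p → ℕ} {α γ : Fin p → ℝ}

/-- `f` embeds the part of `H` on `A`. -/
def IsEmbedOn {U V : Type*} (H : Fin p × Finset U → Bool) (ω : Fin p × Finset V → Bool)
    (A : Finset U) (f : U → V) : Prop :=
  Set.InjOn f A ∧ ∀ e : Fin p × Finset U, e.2 ⊆ A → ω (push f e) = H e

lemma isEmbed_of_coords {U V : Type} [Fintype U] [Fintype V] {H : Fin p × Finset U → Bool}
    {ω : Fin p × Finset V → Bool} {A : Finset U} {f g : U → V} (hf : IsEmbedOn H ω A f)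
    (hg : g ∈ copies f A fun _ => Finset.univ) (hc : ∀ e ∈ coords A, ω (push g e) = H e) :
    IsEmbed H ω g := by
  simp only [copies, Finset.mem_filter, Finset.mem_univ, true_and, implies_true, and_true] at hg
  refine ⟨hg.1, fun e => ?_⟩
  by_cases he : e.2 ⊆ A
  · rw [← hf.2 e he]
    have : push g e = push f e :=
      Prod.ext rfl (Finset.image_congr fun x hx => hg.2 x (he hx))
    rw [this]
  · exact hc e (by simpa [coords] using he)

/-- The extensions by at most `t` vertices of a copy of `H` over `A` whose predimension over `A`
is smaller than that of `H`. -/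
def BadExt (α : Fin p → ℝ) {U : Type} [Fintype U] (H : Fin p × Finset U → Bool) (A : Finset U)
    (t : ℕ) : Type :=
  {x : Σ u : Fin (t + 1), (Fin p × Finset (U ⊕ Fin u) → Bool) //
    Safe α x.2 (A.map Function.Embedding.inl) ∧
      dl α x.2 Finset.univ - dl α x.2 (A.map Function.Embedding.inl) <
        dl α H Finset.univ - dl α H A}

noncomputable instance (α : Fin p → ℝ) {U : Type} [Fintype U] (H : Fin p × Finset U → Bool)
    (A : Finset U) (t : ℕ) : Fintype (BadExt α H A t) :=
  inferInstanceAs (Fintype (Subtype _))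

/-- Each embedding over `A` whose image is not strong is part of a copy of a bad extension. -/
lemma exists_badExt (hirr : IrrHyp α) {U V : Type} [Fintype U] [Fintype V]
    {H : Fin p × Finset U → Bool} {ω : Fin p × Finset V → Bool} {A : Finset U} {f g : U → V}
    {t T : ℕ} (hT : Fintype.card U + t ≤ A.card + T) (v₀ : V)
    (hs : Strong α ω T (A.image f)) (hg : IsEmbed H ω g) (hgf : ∀ x ∈ A, g x = f x)
    (hbad : ¬ Strong α ω t (Finset.univ.image g)) :
    ∃ x : BadExt α H A t, ∃ h : U ⊕ Fin x.1.1 → V,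
      h ∈ copies (Sum.elim f fun _ => v₀) (A.map Function.Embedding.inl)
        (fun _ => Finset.univ) ∧ IsEmbed x.1.2 ω h ∧ h ∘ Sum.inl = g := by
  simp only [Strong, not_forall, not_lt] at hbad
  obtain ⟨Y, hY, hYt, hle⟩ := hbad
  obtain ⟨h2, h2i, h2Y⟩ := exists_map_image_eq (Y \ Finset.univ.image g)
  have h2m : ∀ i, h2 i ∈ Y \ Finset.univ.image g := fun i => by
    rw [← h2Y]
    exact Finset.mem_image_of_mem _ (Finset.mem_univ i)
  have hh : Function.Injective (Sum.elim g h2) := by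
    rw [Sum.elim_injective]
    refine ⟨hg.1, h2i, fun a b hab => ?_⟩
    have := (Finset.mem_sdiff.1 (h2m b)).2
    rw [← hab] at this
    exact this (Finset.mem_image_of_mem _ (Finset.mem_univ a))
  have himg : Finset.univ.image (Sum.elim g h2) = Y := by
    ext y
    have h2y : (∃ i, h2 i = y) ↔ y ∈ Y ∧ y ∉ Finset.univ.image g := by
      have := Finset.ext_iff.1 h2Y y
      rw [Finset.mem_sdiff] at this
      simpa using this
    have hYy : y ∈ Finset.univ.image g → y ∈ Y := fun h => hY.1 h
    simp only [Finset.mem_image, Finset.mem_univ, true_and, Sum.exists, Sum.elim_inl,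
      Sum.elim_inr, h2y] at hYy ⊢
    tauto
  have hA : (A.map Function.Embedding.inl).image (Sum.elim g h2) = A.image f := by
    ext y
    simp only [Finset.mem_image, Finset.mem_map, Function.Embedding.inl_apply]
    constructor
    · rintro ⟨_, ⟨x, hx, rfl⟩, rfl⟩
      exact ⟨x, hx, (hgf x hx).symm⟩
    · rintro ⟨x, hx, rfl⟩
      exact ⟨_, ⟨x, hx, rfl⟩, hgf x hx⟩
  have hA' : A.image g = A.image f := Finset.image_congr fun x hx => hgf x hx
  have he := isEmbed_pull hh ω
  have hd1 := dl_image α he Finset.univ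
  have hd2 := dl_image α he (A.map Function.Embedding.inl)
  have hd3 := dl_image α hg Finset.univ
  have hd4 := dl_image α hg A
  have hne : dl α ω (Finset.univ.image g) ≠ dl α ω Y := fun h =>
    (Finset.card_lt_card hY).ne (card_eq_of_dl_eq hirr h)
  refine ⟨⟨⟨⟨_, Nat.lt_succ_of_le hYt⟩, pull (Sum.elim g h2) ω⟩, ?_, ?_⟩, Sum.elim g h2, ?_, he, rfl⟩
  · refine Strong.safe (t := T) he ?_ ?_
    · rwa [hA]
    · rw [Fintype.card_sum, Fintype.card_fin, Finset.card_map]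
      omega
  · rw [← hd1, ← hd2, ← hd3, ← hd4, himg, hA, hA']
    exact sub_lt_sub_right (lt_of_le_of_ne hle hne.symm) _
  · simp only [copies, Finset.mem_filter, Finset.mem_univ, true_and, implies_true, and_true]
    refine ⟨hh, fun x hx => ?_⟩
    obtain ⟨y, hy, rfl⟩ := Finset.mem_map.1 hx
    exact hgf y hy

lemma numInd_le_sum_numPos (hirr : IrrHyp α) {U V : Type} [Fintype U] [Fintype V]
    {H : Fin p × Finset U → Bool} {ω : Fin p × Finset V → Bool} {A : Finset U} {f : U → V}
    {t T : ℕ} (hT : Fintype.card U + t ≤ A.card + T) (v₀ : V) (hf : IsEmbedOn H ω A f)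
    (hs : Strong α ω T (A.image f))
    (hbad : ∀ g, IsEmbed H ω g → (∀ x ∈ A, g x = f x) → ¬ Strong α ω t (Finset.univ.image g)) :
    numInd H f A (fun _ => Finset.univ) ω ≤ ∑ x : BadExt α H A t,
      numPos x.1.2 (Sum.elim f fun _ => v₀) (A.map Function.Embedding.inl)
        (fun _ => Finset.univ) ω := by
  simp only [numInd, numPos, Finset.sum_boole]
  rw [← Nat.cast_sum, Nat.cast_le]
  refine le_trans (Finset.card_le_card (t := Finset.univ.biUnion fun x : BadExt α H A t =>
    ((copies (Sum.elim f fun _ => v₀) (A.map Function.Embedding.inl)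
      (fun _ => Finset.univ)).filter fun h => ∀ e ∈ (relEdg x.1.2 (A.map Function.Embedding.inl)
        Finset.univ).image (push h), ω e = true).image (· ∘ Sum.inl)) fun g hg => ?_)
    (Finset.card_biUnion_le.trans (Finset.sum_le_sum fun x _ => Finset.card_image_le))
  obtain ⟨hg1, hg2⟩ := Finset.mem_filter.1 hg
  have hge := isEmbed_of_coords hf hg1 hg2
  have hgf : ∀ x ∈ A, g x = f x := (Finset.mem_filter.1 hg1).2.2.1
  obtain ⟨x, h, hc, he, rfl⟩ := exists_badExt hirr hT v₀ hs hge hgf (hbad g hge hgf)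
  refine Finset.mem_biUnion.2 ⟨x, Finset.mem_univ _, Finset.mem_image.2 ⟨h,
    Finset.mem_filter.2 ⟨hc, ?_⟩, rfl⟩⟩
  rw [Finset.forall_mem_image]
  intro e hem
  rw [he.2, (mem_relEdg.1 hem).1]

/-- Almost surely, every embedding of a part of a safe extension whose image is sufficiently
strong extends to an embedding of the whole with strong image. -/
lemma almostSurely_extend (hα : ∀ i, 0 < α i) (hγ : ∀ i, 0 < γ i ∧ γ i ≤ 1) (hirr : IrrHyp α)
    {U : Type} [Fintype U] (H : Fin p × Finset U → Bool)
    (hH : ∀ e, H e = true → e.2.card = k e.1) {A : Finset U} (hA : Safe α H A) {t T : ℕ}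
    (hT : Fintype.card U + t ≤ A.card + T) :
    AlmostSurely k α γ (fun V _ ω => ∀ f : U → V, IsEmbedOn H ω A f →
      Strong α ω T (A.image f) → ∃ g, IsEmbed H ω g ∧ (∀ x ∈ A, g x = f x) ∧
        Strong α ω t (Finset.univ.image g)) := by
  set d := dl α H Finset.univ - dl α H A with hd
  let d' : BadExt α H A t → ℝ := fun x =>
    dl α x.1.2 Finset.univ - dl α x.1.2 (A.map Function.Embedding.inl)
  have hd' : ∀ x, d' x < d := fun x => x.2.2
  obtain ⟨η, hηx, hη⟩ : ∃ η : ℝ, (∀ x, η < (d - d' x) / 2) ∧ 0 < η :=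
    ((eventually_all.2 fun x => (gt_mem_nhds (half_pos (sub_pos.2 (hd' x)))).filter_mono
      nhdsWithin_le_nhds).and self_mem_nhdsWithin).exists (f := 𝓝[>] (0 : ℝ))
  have hpos : AlmostSurely k α γ (fun V _ ω => ∀ (x : BadExt α H A t) (f : U ⊕ Fin x.1.1 → V),
      numPos x.1.2 f (A.map Function.Embedding.inl) (fun _ => Finset.univ) ω ≤
        (Fintype.card V : ℝ) ^ (d' x + (d - d' x) / 2)) :=
    .forall hα hγ fun x => almostSurely_numPos_le hα hγ x.1.2 x.2.1
      (half_pos (sub_pos.2 (hd' x)))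
  refine ((almostSurely_le_numInd hα hγ H hH hA hη).and hα hγ hpos).mono hα hγ ?_
  filter_upwards [eventually_gt_atTop 0, eventually_all.2 fun x : BadExt α H A t =>
    eventually_mul_rpow_le (show d' x + (d - d' x) / 2 < d - η by linarith [hηx x])
      (Fintype.card (BadExt α H A t) + 1)] with n hn0 hn V _ hV ω hω f hf hs
  subst hV
  obtain ⟨v₀⟩ := Fintype.card_pos_iff.1 hn0
  by_contra! hbad
  have h1 := (hω.1 f hf.1).trans ((numInd_le_sum_numPos hirr hT v₀ hf hs hbad).trans
    (Finset.sum_le_sum fun x _ => hω.2 x _))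
  have hpow : (0 : ℝ) < (Fintype.card V : ℝ) ^ (d - η) :=
    Real.rpow_pos_of_pos (by exact_mod_cast hn0) _
  have h2 := Finset.sum_le_sum fun x (_ : x ∈ Finset.univ) => hn x
  rw [← Finset.mul_sum, Finset.sum_const, Finset.card_univ, nsmul_eq_mul] at h2
  have h3 : (0 : ℝ) ≤ Fintype.card (BadExt α H A t) := Nat.cast_nonneg _
  have h4 := mul_le_mul_of_nonneg_left h1 (by positivity :
    (0 : ℝ) ≤ Fintype.card (BadExt α H A t) + 1)
  linarith

end Extension

section Logic

variable {k : Fin p → ℕ} {α γ : Fin p → ℝ}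

/-- The structure on `V` whose relations are given by the hypergraph `ω`. -/
@[reducible] def structOn (k : Fin p → ℕ) (V : Type) (ω : Fin p × Finset V → Bool) :
    (Lang p k).Structure V where
  funMap := fun {_} f _ => f.elim
  RelMap := fun {_} r v => Function.Injective v ∧ ω (r.1, Finset.image v Finset.univ) = true

/-- The tuple `x` satisfies `φ` in the structure given by `ω`. -/
def Sat {V : Type} (ω : Fin p × Finset V → Bool) {r : ℕ}
    (φ : (Lang p k).BoundedFormula Empty r) (x : Fin r → V) : Prop :=
  letI := structOn k V ω
  φ.Realize default x

/-- The tuples `x` and `x'` lie in isomorphic strong subsets with at most `s` elements. -/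
def Corr (α : Fin p → ℝ) (t s : ℕ) {V V' : Type} [Fintype V] [Fintype V']
    (ω : Fin p × Finset V → Bool) (ω' : Fin p × Finset V' → Bool) {r : ℕ}
    (x : Fin r → V) (x' : Fin r → V') : Prop :=
  ∃ (U : Type) (_ : Fintype U) (H : Fin p × Finset U → Bool) (g : U → V) (g' : U → V')
    (v : Fin r → U), Fintype.card U ≤ s ∧ IsEmbed H ω g ∧ IsEmbed H ω' g' ∧
      Strong α ω t (Finset.univ.image g) ∧ Strong α ω' t (Finset.univ.image g') ∧
      g ∘ v = x ∧ g' ∘ v = x'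

section Corr

variable {V V' : Type} [Fintype V] [Fintype V'] {ω : Fin p × Finset V → Bool}
  {ω' : Fin p × Finset V' → Bool} {r : ℕ} {x : Fin r → V} {x' : Fin r → V'}

lemma Corr.symm {t s : ℕ} (h : Corr α t s ω ω' x x') : Corr α t s ω' ω x' x := by
  obtain ⟨U, _, H, g, g', v, h1, h2, h3, h4, h5, h6, h7⟩ := h
  exact ⟨U, _, H, g', g, v, h1, h3, h2, h5, h4, h7, h6⟩

lemma Corr.mono {t t' s : ℕ} (h : Corr α t' s ω ω' x x') (ht : t ≤ t') :
    Corr α t s ω ω' x x' := by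
  obtain ⟨U, _, H, g, g', v, h1, h2, h3, h4, h5, h6⟩ := h
  exact ⟨U, _, H, g, g', v, h1, h2, h3, h4.mono ht, h5.mono ht, h6⟩

lemma Corr.eq_iff {t s : ℕ} (h : Corr α t s ω ω' x x') (i j : Fin r) :
    x i = x j ↔ x' i = x' j := by
  obtain ⟨U, _, H, g, g', v, -, h2, h3, -, -, rfl, rfl⟩ := h
  exact (h2.1.eq_iff).trans (h3.1.eq_iff).symm

lemma Corr.injective_iff {t s l : ℕ} (h : Corr α t s ω ω' x x') (c : Fin l → Fin r) :
    Function.Injective (x ∘ c) ↔ Function.Injective (x' ∘ c) := by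
  simp only [Function.Injective, Function.comp_apply, h.eq_iff]

lemma Corr.rel_eq {t s l : ℕ} (h : Corr α t s ω ω' x x') (c : Fin l → Fin r) (i : Fin p) :
    ω (i, Finset.univ.image (x ∘ c)) = ω' (i, Finset.univ.image (x' ∘ c)) := by
  obtain ⟨U, _, H, g, g', v, -, h2, h3, -, -, rfl, rfl⟩ := h
  have h4 := h2.2 (i, Finset.univ.image (v ∘ c))
  have h5 := h3.2 (i, Finset.univ.image (v ∘ c))
  simp only [push, Finset.image_image] at h4 h5
  exact h4.trans h5.symm

end Corr

/-- The properties of a random structure that allow to extend correspondences. -/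
def Extends (k : Fin p → ℕ) (α : Fin p → ℝ) (t s S : ℕ) (V : Type) [Fintype V]
    (ω : Fin p × Finset V → Bool) : Prop :=
  Nonempty V ∧ (∀ e, ω e = true → e.2.card = k e.1) ∧ (∀ X, X.card ≤ S → 0 ≤ dl α ω X) ∧
    ∀ (b : Fin (s + S + 1)) (H : {H : Fin p × Finset (Fin b) → Bool //
        ∀ e, H e = true → e.2.card = k e.1})
      (A : {A : Finset (Fin b) // Safe α H.1 A ∧ (b : ℕ) ≤ A.card + S})
      (f : Fin b → V), IsEmbedOn H.1 ω A.1 f → Strong α ω (S + t) (A.1.image f) →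
        ∃ g, IsEmbed H.1 ω g ∧ (∀ x ∈ A.1, g x = f x) ∧ Strong α ω t (Finset.univ.image g)

lemma almostSurely_extends (hα : ∀ i, 0 < α i) (hγ : ∀ i, 0 < γ i ∧ γ i ≤ 1) (hirr : IrrHyp α)
    (t s S : ℕ) : AlmostSurely k α γ (Extends k α t s S) := by
  have hval := almostSurely_valid (k := k) hα hγ
  have hne : AlmostSurely k α γ (fun V _ _ => Nonempty V) :=
    hval.mono hα hγ <| (eventually_gt_atTop 0).mono fun n hn V _ hV _ _ =>
      Fintype.card_pos_iff.1 (hV ▸ hn)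
  refine hne.and hα hγ (hval.and hα hγ ((almostSurely_dl_nonneg hα hγ S).and hα hγ
    (.forall hα hγ fun b => .forall hα hγ fun H => .forall hα hγ fun A =>
      almostSurely_extend hα hγ hirr H.1 H.2 A.2.1 ?_)))
  rw [Fintype.card_fin]
  have := A.2.2
  omega

lemma Corr.extend {s t S : ℕ} (hα : ∀ i, 0 < α i)
    {V V' : Type} [Fintype V] [Fintype V'] {ω : Fin p × Finset V → Bool}
    {ω' : Fin p × Finset V' → Bool} {r : ℕ}
    (hS : (∀ X : Finset V, X.card ≤ S → 0 ≤ dl α ω X) →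
      ∀ X : Finset V, X.card ≤ r + 1 → ∃ Y, X ⊆ Y ∧ Y.card ≤ S ∧ Strong α ω t Y)
    (hω : Extends k α t s S V ω) (hω' : Extends k α t s S V' ω')
    {x : Fin r → V} {x' : Fin r → V'} (h : Corr α (S + t) s ω ω' x x') (y : V) :
    ∃ y', Corr α t S ω ω' (Fin.snoc x y : Fin (r + 1) → V) (Fin.snoc x' y' : Fin (r + 1) → V') := by
  obtain ⟨U, _, H, g, g', v, h1, h2, h3, h4, h5, rfl, rfl⟩ := h
  obtain ⟨⟨v₀⟩, -, -, hext⟩ := hω'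
  obtain ⟨-, hval, hdl, -⟩ := hω
  obtain ⟨Y, hXY, hYS, hYs⟩ := hS hdl (insert y (Finset.univ.image (g ∘ v)))
    ((Finset.card_insert_le _ _).trans (Nat.succ_le_succ (Finset.card_image_le.trans (by simp))))
  obtain ⟨Z, hZ⟩ : ∃ Z, Z = Finset.univ.image g ∪ Y := ⟨_, rfl⟩
  have hgZ' : ∀ u, g u ∈ Z := fun u =>
    hZ ▸ Finset.mem_union_left _ (Finset.mem_image_of_mem g (Finset.mem_univ u))
  have hYZ : Y ⊆ Z := hZ ▸ Finset.subset_union_right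
  have hgcard : (Finset.univ.image g).card = Fintype.card U :=
    Finset.card_image_of_injective _ h2.1
  have hZcard : Z.card ≤ (Finset.univ.image g).card + S :=
    hZ ▸ (Finset.card_union_le _ _).trans (Nat.add_le_add_left hYS _)
  obtain ⟨h, hh, hhZ⟩ := exists_map_image_eq Z
  have hhe := isEmbed_pull hh ω
  have hmem : ∀ z ∈ Z, ∃ i, h i = z := fun z hz => by
    rw [← hhZ] at hz
    simpa using hz
  have hgZ : ∀ u, ∃ i, h i = g u := fun u => hmem _ (hgZ' u)
  let A : Finset (Fin Z.card) := Finset.univ.filter fun i => ∃ u, g u = h i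
  have hAimg : A.image h = Finset.univ.image g := by
    ext z
    simp only [A, Finset.mem_image, Finset.mem_filter, Finset.mem_univ, true_and]
    constructor
    · rintro ⟨i, ⟨u, hu⟩, rfl⟩
      exact ⟨u, hu⟩
    · rintro ⟨u, rfl⟩
      obtain ⟨i, hi⟩ := hgZ u
      exact ⟨i, ⟨u, hi.symm⟩, hi⟩
  have hAcard : Z.card ≤ A.card + S := by
    rwa [← Finset.card_image_of_injective A hh, hAimg]
  have hA : Safe α (pull h ω) A := by
    refine Strong.safe (t := S + t) hhe (by rwa [hAimg]) ?_
    rw [Fintype.card_fin]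
    omega
  let f : Fin Z.card → V' := fun i => if hi : ∃ u, g u = h i then g' hi.choose else v₀
  have hf : ∀ i u, g u = h i → f i = g' u := fun i u hu => by
    have hi : ∃ u, g u = h i := ⟨u, hu⟩
    have : hi.choose = u := h2.1 (hi.choose_spec.trans hu.symm)
    simp only [f, dif_pos hi, this]
  have hfA : IsEmbedOn (pull h ω) ω' A f := by
    refine ⟨fun i hi j hj hij => ?_, fun e he => ?_⟩
    · obtain ⟨u, hu⟩ : ∃ u, g u = h i := by simpa [A] using hi
      obtain ⟨w, hw⟩ : ∃ u, g u = h j := by simpa [A] using hj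
      rw [hf i u hu, hf j w hw] at hij
      exact hh (hu.symm.trans ((congrArg g (h3.1 hij)).trans hw))
    · let C : Finset U := Finset.univ.filter fun u => ∃ i ∈ e.2, g u = h i
      have he' : ∀ i ∈ e.2, ∃ u, g u = h i := fun i hi => by simpa [A] using he hi
      have hC1 : push h e = push g (e.1, C) := by
        refine Prod.ext rfl ?_
        ext z
        simp only [push, C, Finset.mem_image, Finset.mem_filter, Finset.mem_univ, true_and]
        constructor
        · rintro ⟨i, hi, rfl⟩
          obtain ⟨u, hu⟩ := he' i hi
          exact ⟨u, ⟨i, hi, hu⟩, hu⟩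
        · rintro ⟨u, ⟨i, hi, hu⟩, rfl⟩
          exact ⟨i, hi, hu.symm⟩
      have hC2 : push f e = push g' (e.1, C) := by
        refine Prod.ext rfl ?_
        ext z
        simp only [push, C, Finset.mem_image, Finset.mem_filter, Finset.mem_univ, true_and]
        constructor
        · rintro ⟨i, hi, rfl⟩
          obtain ⟨u, hu⟩ := he' i hi
          exact ⟨u, ⟨i, hi, hu⟩, (hf i u hu).symm⟩
        · rintro ⟨u, ⟨i, hi, hu⟩, rfl⟩
          exact ⟨i, hi, hf i u hu⟩
      rw [pull, hC1, hC2, h2.2, h3.2]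
  have hfimg : A.image f = Finset.univ.image g' := by
    ext z
    simp only [A, Finset.mem_image, Finset.mem_filter, Finset.mem_univ, true_and]
    constructor
    · rintro ⟨i, ⟨u, hu⟩, rfl⟩
      exact ⟨u, (hf i u hu).symm⟩
    · rintro ⟨u, rfl⟩
      obtain ⟨i, hi⟩ := hgZ u
      exact ⟨i, ⟨u, hi.symm⟩, hf i u hi.symm⟩
  obtain ⟨g₂, hg₂, hg₂f, hg₂s⟩ := hext ⟨Z.card, by omega⟩ ⟨pull h ω, fun e he =>
    (Finset.card_image_of_injective _ hh).symm.trans (hval (push h e) he)⟩ ⟨A, hA, hAcard⟩ f hfA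
    (by rwa [hfimg])
  obtain ⟨hY, hYi, hYimg⟩ := exists_map_image_eq Y
  have hmemY : ∀ z ∈ Y, ∃ i, hY i = z := fun z hz => by
    rw [← hYimg] at hz
    simpa using hz
  have hYmem : ∀ i, hY i ∈ Y := fun i => by
    have := Finset.mem_image_of_mem hY (Finset.mem_univ i)
    rwa [hYimg] at this
  choose j hj using fun i => hmem _ (hYZ (hYmem i))
  have hjY : h ∘ j = hY := funext hj
  have hjinj : Function.Injective j := .of_comp (f := h) (hjY ▸ hYi)
  obtain ⟨i₀, hi₀⟩ := hmemY y (hXY (Finset.mem_insert_self _ _))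
  choose i hi using fun m => hmemY (g (v m))
    (hXY (Finset.mem_insert_of_mem (Finset.mem_image_of_mem (g ∘ v) (Finset.mem_univ m))))
  refine ⟨g₂ (j i₀), Fin Y.card, inferInstance, pull hY ω, hY, g₂ ∘ j, Fin.snoc i i₀, ?_,
    isEmbed_pull hYi ω, ⟨hg₂.1.comp hjinj, fun e => ?_⟩, by rwa [hYimg], ?_, ?_, ?_⟩
  · rwa [Fintype.card_fin]
  · rw [push_comp, hg₂.2]
    change ω (push h (push j e)) = ω (push hY e)
    rw [← push_comp, hjY]
  · rw [← Finset.image_image]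
    refine Strong.image_of_isEmbed hα hhe hg₂ ?_ hg₂s
    rwa [Finset.image_image, hjY, hYimg]
  · rw [Fin.comp_snoc, hi₀, show hY ∘ i = g ∘ v from funext hi]
  · rw [Fin.comp_snoc]
    refine congrArg (fun z => Fin.snoc (α := fun _ => V') z (g₂ (j i₀))) (funext fun m => ?_)
    have hm : h (j (i m)) = g (v m) := (hj _).trans (hi m)
    rw [Function.comp_apply, Function.comp_apply, hg₂f _ (by simpa [A] using ⟨_, hm.symm⟩),
      hf _ _ hm.symm, Function.comp_apply]

lemma exists_realize_eq {r : ℕ} (τ : (Lang p k).Term (Empty ⊕ Fin r)) :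
    ∃ i, ∀ (V : Type) (ω : Fin p × Finset V → Bool) (x : Fin r → V),
      (letI := structOn k V ω; τ.realize (Sum.elim default x)) = x i := by
  cases τ with
  | var a =>
    rcases a with a | i
    · exact a.elim
    · exact ⟨i, fun _ _ _ => rfl⟩
  | func f _ => exact f.elim

lemma exists_almostSurely_sat_iff (hα : ∀ i, 0 < α i) (hγ : ∀ i, 0 < γ i ∧ γ i ≤ 1)
    (hirr : IrrHyp α) {r : ℕ} (φ : (Lang p k).BoundedFormula Empty r) :
    ∃ t : ℕ, ∀ s : ℕ, ∃ Q : ∀ (V : Type) [Fintype V], (Fin p × Finset V → Bool) → Prop,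
      AlmostSurely k α γ Q ∧ ∀ (V V' : Type) [Fintype V] [Fintype V']
        (ω : Fin p × Finset V → Bool) (ω' : Fin p × Finset V' → Bool), Q V ω → Q V' ω' →
          ∀ x x', Corr α t s ω ω' x x' → (Sat ω φ x ↔ Sat ω' φ x') := by
  induction φ with
  | falsum =>
    exact ⟨0, fun _ => ⟨_, almostSurely_valid hα hγ, fun _ _ _ _ _ _ _ _ _ _ _ => Iff.rfl⟩⟩
  | equal τ₁ τ₂ =>
    refine ⟨0, fun _ => ⟨_, almostSurely_valid hα hγ, fun V V' _ _ ω ω' _ _ x x' h => ?_⟩⟩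
    obtain ⟨i, hi⟩ := exists_realize_eq τ₁
    obtain ⟨j, hj⟩ := exists_realize_eq τ₂
    have h1 : ∀ (V : Type) (ω : Fin p × Finset V → Bool) x,
        Sat ω (.equal τ₁ τ₂) x ↔ x i = x j := fun V ω x => by
      rw [← hi V ω x, ← hj V ω x]
      rfl
    rw [h1, h1]
    exact h.eq_iff i j
  | rel R τ =>
    refine ⟨0, fun _ => ⟨_, almostSurely_valid hα hγ, fun V V' _ _ ω ω' _ _ x x' h => ?_⟩⟩
    choose c hc using fun j => exists_realize_eq (τ j)
    have h1 : ∀ (V : Type) (ω : Fin p × Finset V → Bool) x, Sat ω (.rel R τ) x ↔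
        Function.Injective (x ∘ c) ∧ ω (R.1, Finset.univ.image (x ∘ c)) = true := fun V ω x => by
      have h2 : x ∘ c = fun j => letI := structOn k V ω; (τ j).realize (Sum.elim default x) :=
        funext fun j => (hc j V ω x).symm
      rw [h2]
      rfl
    rw [h1, h1, h.injective_iff, h.rel_eq]
  | imp φ ψ hφ hψ =>
    obtain ⟨t, ht⟩ := hφ
    obtain ⟨t', ht'⟩ := hψ
    refine ⟨max t t', fun s => ?_⟩
    obtain ⟨Q, hQ, h⟩ := ht s
    obtain ⟨Q', hQ', h'⟩ := ht' s
    refine ⟨_, hQ.and hα hγ hQ', fun V V' _ _ ω ω' hω hω' x x' hx => ?_⟩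
    have h1 := h V V' ω ω' hω.1 hω'.1 x x' (hx.mono (le_max_left _ _))
    have h2 := h' V V' ω ω' hω.2 hω'.2 x x' (hx.mono (le_max_right _ _))
    exact imp_congr h1 h2
  | @all r φ hφ =>
    obtain ⟨t, ht⟩ := hφ
    obtain ⟨S, hS⟩ := exists_strong_superset hα hirr (r + 1) t
    obtain ⟨Q, hQ, h⟩ := ht S
    refine ⟨S + t, fun s => ⟨_, hQ.and hα hγ (almostSurely_extends hα hγ hirr t s S),
      fun V V' _ _ ω ω' hω hω' x x' hx => ⟨fun hall y' => ?_, fun hall y => ?_⟩⟩⟩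
    · obtain ⟨y, hy⟩ := hx.symm.extend hα (hS V' ω') hω'.2 hω.2 y'
      exact (h V V' ω ω' hω.1 hω'.1 _ _ hy.symm).1 (hall y)
    · obtain ⟨y', hy⟩ := hx.extend hα (hS V ω) hω.2 hω'.2 y
      exact (h V V' ω ω' hω.1 hω'.1 _ _ hy).2 (hall y')

end Logic

section ZeroOneLaw

variable {k : Fin p → ℕ} {α γ : Fin p → ℝ}

lemma corr_elim (hirr : IrrHyp α) {t : ℕ} {V V' : Type} [Fintype V] [Fintype V']
    {ω : Fin p × Finset V → Bool} {ω' : Fin p × Finset V' → Bool}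
    (hα : ∀ i, 0 < α i)
    (h : ∀ X, X.card ≤ t → 0 ≤ dl α ω X) (h' : ∀ X, X.card ≤ t → 0 ≤ dl α ω' X)
    (x : Fin 0 → V) (x' : Fin 0 → V') : Corr α t 0 ω ω' x x' := by
  have key : ∀ (V : Type) [Fintype V] (ω : Fin p × Finset V → Bool) (g : Empty → V),
      (∀ X, X.card ≤ t → 0 ≤ dl α ω X) →
        IsEmbed (fun _ => false) ω g ∧ Strong α ω t (Finset.univ.image g) := by
    intro V _ ω g h
    have hnot : ∀ i, ω (i, ∅) = false := fun i => by
      by_contra hi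
      rw [Bool.not_eq_false] at hi
      have h0 := h ∅ (by simp)
      have h1 : α i ≤ ∑ e ∈ edg ω ∅, α e.1 :=
        Finset.single_le_sum (f := fun e : Fin p × Finset V => α e.1)
          (fun e _ => (hα e.1).le) (mem_edg.2 ⟨hi, subset_rfl⟩)
      rw [dl, Finset.card_empty, Nat.cast_zero] at h0
      linarith [hα i]
    have hdl : dl α ω ∅ = 0 := by
      have : edg ω ∅ = ∅ := by
        refine Finset.eq_empty_of_forall_notMem fun e he => ?_
        obtain ⟨h1, h2⟩ := mem_edg.1 he
        have h3 : e = (e.1, ∅) := Prod.ext rfl (Finset.subset_empty.1 h2)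
        rw [h3, hnot] at h1
        exact Bool.false_ne_true h1
      simp [dl, this]
    refine ⟨⟨fun a => a.elim, fun e => ?_⟩, fun Y hY hYt => ?_⟩
    · have : push g e = (e.1, ∅) :=
        Prod.ext rfl (by simp [push, Finset.eq_empty_of_isEmpty e.2])
      rw [this, hnot]
    · have himg : Finset.univ.image g = ∅ := by simp
      rw [himg] at hY hYt ⊢
      rw [Finset.sdiff_empty] at hYt
      refine lt_of_le_of_ne (hdl ▸ h Y hYt) fun heq => ?_
      exact (Finset.card_lt_card hY).ne (card_eq_of_dl_eq hirr heq)
  obtain ⟨h1, h2⟩ := key V ω Empty.elim h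
  obtain ⟨h3, h4⟩ := key V' ω' Empty.elim h'
  exact ⟨Empty, inferInstance, _, _, _, Fin.elim0, by simp, h1, h3, h2, h4,
    Subsingleton.elim _ _, Subsingleton.elim _ _⟩

/-- Each sentence or its negation holds almost surely. -/
lemma almostSurely_sat_or (hα : ∀ i, 0 < α i) (hγ : ∀ i, 0 < γ i ∧ γ i ≤ 1) (hirr : IrrHyp α)
    (φ : (Lang p k).Sentence) :
    AlmostSurely k α γ (fun V _ ω => Sat ω φ (default : Fin 0 → V)) ∨
      AlmostSurely k α γ (fun V _ ω => ¬ Sat ω φ (default : Fin 0 → V)) := by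
  obtain ⟨t, ht⟩ := exists_almostSurely_sat_iff hα hγ hirr φ
  obtain ⟨Q, hQ, h⟩ := ht 0
  have hE := hQ.and hα hγ (almostSurely_dl_nonneg hα hγ t)
  by_cases hex : ∃ (V : Type) (_ : Fintype V) (ω : Fin p × Finset V → Bool),
      (Q V ω ∧ ∀ X, X.card ≤ t → 0 ≤ dl α ω X) ∧ Sat ω φ (default : Fin 0 → V)
  · obtain ⟨V, _, ω, hω, hsat⟩ := hex
    exact .inl (hE.mono hα hγ (.of_forall fun n V' _ _ ω' hω' =>
      (h V V' ω ω' hω.1 hω'.1 _ _ (corr_elim hirr hα hω.2 hω'.2 _ _)).1 hsat))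
  · exact .inr (hE.mono hα hγ (.of_forall fun n V _ _ ω hω hsat =>
      hex ⟨V, inferInstance, ω, hω, hsat⟩))

lemma realize_structOf_iff (n : ℕ) (E : Config p n) (φ : (Lang p k).Sentence) :
    (letI := structOf k n E; (Fin n) ⊨ φ) ↔
      Sat (fun e => E e.1 e.2) φ (default : Fin 0 → Fin n) := by
  have : structOf k n E = structOn k (Fin n) (fun e => E e.1 e.2) := by
    unfold structOf structOn
    congr!
  rw [this]
  rfl

lemma weight_eq_prod_edgeProb (n : ℕ) (E : Config p n)
    (hE : ∀ i C, E i C = true → C.card = k i) :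
    weight k α γ n E = ∏ e : Fin p × Finset (Fin n),
      if E e.1 e.2 then edgeProb k α γ (Fin n) e else 1 - edgeProb k α γ (Fin n) e := by
  rw [Fintype.prod_prod_type, weight]
  refine Finset.prod_congr rfl fun i _ => ?_
  rw [Finset.prod_filter]
  refine Finset.prod_congr rfl fun C _ => ?_
  by_cases hC : C.card = k i
  · simp [hC, edgeProb, rateAt]
  · have : E i C = false := by
      rw [← Bool.not_eq_true]
      exact fun h => hC (hE i C h)
    simp [hC, edgeProb, this]

lemma Pn_eq_pr (n : ℕ) (φ : (Lang p k).Sentence) :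
    Pn k α γ n φ = pr (edgeProb k α γ (Fin n)) (fun ω => Sat ω φ (default : Fin 0 → Fin n)) := by
  rw [Pn, Pev, pr, ex, validE, Finset.sum_filter]
  refine Finset.sum_equiv (Equiv.curry (Fin p) (Finset (Fin n)) Bool).symm (by simp) fun E _ => ?_
  change _ = (∏ e : Fin p × Finset (Fin n),
      if E e.1 e.2 then edgeProb k α γ (Fin n) e else 1 - edgeProb k α γ (Fin n) e) *
    if Sat (fun e => E e.1 e.2) φ (default : Fin 0 → Fin n) then 1 else 0
  simp only [realize_structOf_iff]
  by_cases hE : ∀ i C, E i C = true → C.card = k i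
  · rw [if_pos hE, weight_eq_prod_edgeProb n E hE, mul_ite, mul_one, mul_zero]
  · rw [if_neg hE]
    push Not at hE
    obtain ⟨i, C, h1, h2⟩ := hE
    rw [Finset.prod_eq_zero (Finset.mem_univ (i, C)), zero_mul]
    simp [h1, h2, edgeProb]

lemma AlmostSurely.tendsto_pr (hα : ∀ i, 0 < α i) (hγ : ∀ i, 0 < γ i ∧ γ i ≤ 1)
    {Q : ∀ (V : Type) [Fintype V], (Fin p × Finset V → Bool) → Prop}
    (hQ : AlmostSurely k α γ Q) :
    Tendsto (fun n => pr (edgeProb k α γ (Fin n)) (fun ω => ¬ Q (Fin n) ω)) atTop (𝓝 0) := by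
  refine tendsto_order.2 ⟨fun a ha => .of_forall fun n =>
    ha.trans_le (pr_nonneg (edgeProb_mem hα hγ _) _), fun a ha => ?_⟩
  obtain ⟨N, hN⟩ := hQ (a / 2) (half_pos ha)
  filter_upwards [eventually_ge_atTop N] with n hn
  exact (hN (Fin n) (by simpa using hn)).trans_lt (half_lt_self ha)

end ZeroOneLaw

-- STATEMENT 0
theorem zero_one_law (k : Fin p → ℕ) (α γ : Fin p → ℝ)
    (hα : ∀ i, 0 < α i ∧ α i ≤ 1) (hγ : ∀ i, 0 < γ i ∧ γ i ≤ 1)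
    (hirr : IrrHyp α) (φ : (Lang p k).Sentence) :
    Tendsto (fun n => Pn k α γ n φ) atTop (𝓝 0) ∨
      Tendsto (fun n => Pn k α γ n φ) atTop (𝓝 1) := by
  have hα' : ∀ i, 0 < α i := fun i => (hα i).1
  simp only [Pn_eq_pr]
  rcases almostSurely_sat_or hα' hγ hirr φ with h | h
  · right
    simpa only [pr_not, sub_sub_cancel, sub_zero] using (h.tendsto_pr hα' hγ).const_sub 1
  · left
    simpa only [not_not] using h.tendsto_pr hα' hγ
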